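/- Let k be a field, H a commutative Hopf algebra over k with bijective antipode, and let M, N, P be left-right Yetter-Drinfeld modules over H with N finitely generated and projective as a left H-module. Then for every i ≥ 0 there is a k-linear isomorphism Ext^i(M, Hom_H(N, P)) ≅ Ext^i(M ⊗_H N, P), where Ext^i denotes the i-th right derived functor of the H-linear H-colinear Hom functor Hom_H^H(−, −) in the category of Yetter-Drinfeld modules. -/

import Mathlib

/-!
Common definitions for formalizing "Semisimplicity of the categories of
Yetter-Drinfeld modules and Long dimodules" (Caenepeel, Guédénon).
-/

open TensorProduct

noncomputable section
namespace YDPaper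

section RingPart

variable (k H : Type) [CommRing k] [Ring H] [HopfAlgebra k H]

/-- `ρ : M →ₗ[k] M ⊗[k] H` is a (coassociative, counital) right `H`-comodule
structure on `M`. -/
def IsComod {M : Type} [AddCommGroup M] [Module k M] (ρ : M →ₗ[k] M ⊗[k] H) : Prop :=
  (∀ m : M, (TensorProduct.rid k M)
      ((LinearMap.lTensor M (Coalgebra.counit (R := k) (A := H))) (ρ m)) = m) ∧
  (∀ m : M, (TensorProduct.assoc k M H H) ((LinearMap.rTensor H ρ) (ρ m)) =
      (LinearMap.lTensor M (Coalgebra.comul (R := k) (A := H))) (ρ m))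

/-- The iterated comultiplication `h ↦ (h₁ ⊗ h₂) ⊗ h₃`. -/
def Delta2 : H →ₗ[k] (H ⊗[k] H) ⊗[k] H :=
  (LinearMap.rTensor H (Coalgebra.comul (R := k) (A := H))).comp
    (Coalgebra.comul (R := k) (A := H))

/-- The Yetter-Drinfeld compatibility condition
`ρ(h • m) = h₂ • m₀ ⊗ h₃ m₁ S⁻¹(h₁)`, expressed via arbitrary Sweedler
decompositions of `Δ²(h)` and `ρ(m)` into finite sums of pure tensors. -/
def IsYDCompat (Sinv : H →ₗ[k] H) {M : Type} [AddCommGroup M] [Module k M] [Module H M]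
    (ρ : M →ₗ[k] M ⊗[k] H) : Prop :=
  ∀ (h : H) (m : M) (s t : Finset ℕ) (a b c : ℕ → H) (m₀ : ℕ → M) (m₁ : ℕ → H),
    (∑ i ∈ s, (a i ⊗ₜ[k] b i) ⊗ₜ[k] c i) = Delta2 k H h →
    (∑ j ∈ t, m₀ j ⊗ₜ[k] m₁ j) = ρ m →
    ρ (h • m) = ∑ i ∈ s, ∑ j ∈ t, (b i • m₀ j) ⊗ₜ[k] (c i * m₁ j * Sinv (a i))

/-- The `k`-linear map `m ↦ h • m`. -/
def smulMap {M : Type} [AddCommGroup M] [Module k M] [Module H M] [SMulCommClass H k M]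
    (h : H) : M →ₗ[k] M where
  toFun m := h • m
  map_add' := smul_add h
  map_smul' c m := (smul_comm h c m)

/-- The Long dimodule compatibility condition `ρ(h • m) = h • m₀ ⊗ m₁`. -/
def IsLongCompat {M : Type} [AddCommGroup M] [Module k M] [Module H M] [SMulCommClass H k M]
    (ρ : M →ₗ[k] M ⊗[k] H) : Prop :=
  ∀ (h : H) (m : M), ρ (h • m) = (LinearMap.rTensor H (smulMap k H h)) (ρ m)

/-- Morphisms in the categories of Yetter-Drinfeld modules and of Long dimodules:
`H`-linear and `H`-colinear maps. -/
def IsHom {A B : Type} [AddCommGroup A] [Module k A] [Module H A]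
    [AddCommGroup B] [Module k B] [Module H B]
    (ρA : A →ₗ[k] A ⊗[k] H) (ρB : B →ₗ[k] B ⊗[k] H) (f : A →ₗ[k] B) : Prop :=
  (∀ (h : H) (a : A), f (h • a) = h • f a) ∧
  ρB.comp f = (LinearMap.rTensor H f).comp ρA

/-- `H`-colinearity of a `k`-linear map between right `H`-comodules. -/
def IsColin {A B : Type} [AddCommGroup A] [Module k A]
    [AddCommGroup B] [Module k B]
    (ρA : A →ₗ[k] A ⊗[k] H) (ρB : B →ₗ[k] B ⊗[k] H) (f : A →ₗ[k] B) : Prop :=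
  ρB.comp f = (LinearMap.rTensor H f).comp ρA

/-- A bundled left-right Yetter-Drinfeld module over `H` (with chosen inverse `Sinv`
of the antipode). -/
structure YDCat (Sinv : H →ₗ[k] H) where
  M : Type
  [iAdd : AddCommGroup M]
  [iModk : Module k M]
  [iModH : Module H M]
  [iTower : IsScalarTower k H M]
  [iComm : SMulCommClass H k M]
  ρ : M →ₗ[k] M ⊗[k] H
  comod : IsComod k H ρ
  compat : IsYDCompat k H Sinv ρ

attribute [instance] YDCat.iAdd YDCat.iModk YDCat.iModH YDCat.iTower YDCat.iComm

/-- A bundled left-right Long dimodule over `H`. -/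
structure LongCat where
  M : Type
  [iAdd : AddCommGroup M]
  [iModk : Module k M]
  [iModH : Module H M]
  [iTower : IsScalarTower k H M]
  [iComm : SMulCommClass H k M]
  ρ : M →ₗ[k] M ⊗[k] H
  comod : IsComod k H ρ
  compat : IsLongCompat k H ρ

attribute [instance] LongCat.iAdd LongCat.iModk LongCat.iModH LongCat.iTower LongCat.iComm

/-- A bundled right `H`-comodule. -/
structure ComodCat where
  V : Type
  [iAdd : AddCommGroup V]
  [iModk : Module k V]
  ρ : V →ₗ[k] V ⊗[k] H
  comod : IsComod k H ρ

attribute [instance] ComodCat.iAdd ComodCat.iModk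

section Subobjects

variable {k H}
variable {M : Type} [AddCommGroup M] [Module k M] [Module H M] [IsScalarTower k H M]

/-- A subobject in the category of Yetter-Drinfeld modules (or Long dimodules):
an `H`-submodule which is stable under the coaction, i.e. `ρ(p) ⊆ p ⊗ H`. -/
def IsSubobject (ρ : M →ₗ[k] M ⊗[k] H) (p : Submodule H M) : Prop :=
  ∀ m ∈ p, ρ m ∈ LinearMap.range (LinearMap.rTensor H (p.restrictScalars k).subtype)

/-- A simple subobject: a nonzero coaction-stable `H`-submodule with no proper
nonzero coaction-stable `H`-submodules. -/
def IsSimpleSubobject (ρ : M →ₗ[k] M ⊗[k] H) (p : Submodule H M) : Prop :=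
  IsSubobject ρ p ∧ p ≠ ⊥ ∧
    ∀ q : Submodule H M, IsSubobject ρ q → q ≤ p → q = ⊥ ∨ q = p

/-- `M` is the (internal) direct sum of a family of simple subobjects which are
finitely generated as `H`-modules. -/
def IsSemisimpleObj (ρ : M →ₗ[k] M ⊗[k] H) : Prop :=
  ∃ (ι : Type) (S : ι → Submodule H M),
    (∀ i, IsSimpleSubobject ρ (S i) ∧ (S i).FG) ∧
    iSupIndep S ∧ (⨆ i, S i) = ⊤

end Subobjects

section Subcomodules

variable {k H}
variable {V : Type} [AddCommGroup V] [Module k V]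

/-- A subcomodule: a `k`-submodule stable under the coaction. -/
def IsSubcomod (ρ : V →ₗ[k] V ⊗[k] H) (p : Submodule k V) : Prop :=
  ∀ v ∈ p, ρ v ∈ LinearMap.range (LinearMap.rTensor H p.subtype)

/-- A simple subcomodule. -/
def IsSimpleSubcomod (ρ : V →ₗ[k] V ⊗[k] H) (p : Submodule k V) : Prop :=
  IsSubcomod ρ p ∧ p ≠ ⊥ ∧
    ∀ q : Submodule k V, IsSubcomod ρ q → q ≤ p → q = ⊥ ∨ q = p

/-- A comodule is semisimple if it is the internal direct sum of a family of simple
subcomodules. -/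
def IsSemisimpleComod (ρ : V →ₗ[k] V ⊗[k] H) : Prop :=
  ∃ (ι : Type) (S : ι → Submodule k V),
    (∀ i, IsSimpleSubcomod ρ (S i)) ∧ iSupIndep S ∧ (⨆ i, S i) = ⊤

end Subcomodules

/-- `H` is cosemisimple: every right `H`-comodule is a direct sum of simple
subcomodules. -/
def Cosemisimple : Prop := ∀ C : ComodCat k H, IsSemisimpleComod C.ρ

section Coinv

variable {k H}
variable {A B : Type} [AddCommGroup A] [Module k A] [AddCommGroup B] [Module k B]

/-- The coinvariants `M^{co H} = { m | ρ m = m ⊗ 1 }` of a right `H`-comodule. -/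
def coinv (ρ : A →ₗ[k] A ⊗[k] H) : Submodule k A :=
  LinearMap.ker (ρ - (TensorProduct.mk k A H).flip 1)

lemma mem_coinv {ρ : A →ₗ[k] A ⊗[k] H} {a : A} :
    a ∈ coinv ρ ↔ ρ a = a ⊗ₜ[k] (1 : H) := by
  simp [coinv, LinearMap.mem_ker, sub_eq_zero]

/-- The map induced on coinvariants by an `H`-colinear map. -/
def coinvMap {ρA : A →ₗ[k] A ⊗[k] H} {ρB : B →ₗ[k] B ⊗[k] H} (f : A →ₗ[k] B)
    (hf : IsColin k H ρA ρB f) : ↥(coinv ρA) →ₗ[k] ↥(coinv ρB) :=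
  f.restrict (fun a ha => by
    have h1 : ρA a = a ⊗ₜ[k] (1 : H) := mem_coinv.1 ha
    have h2 : ρB (f a) = (LinearMap.rTensor H f) (ρA a) := by
      have := congrArg (fun (g : A →ₗ[k] B ⊗[k] H) => g a) hf
      simpa using this
    rw [mem_coinv, h2, h1, LinearMap.rTensor_tmul])

end Coinv

/-- Exactness of the coinvariants functor on the category of Yetter-Drinfeld
modules. -/
def CoinvExactYD (Sinv : H →ₗ[k] H) : Prop :=
  ∀ (A B C : YDCat k H Sinv) (f : A.M →ₗ[k] B.M) (g : B.M →ₗ[k] C.M)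
    (hf : IsHom k H A.ρ B.ρ f) (hg : IsHom k H B.ρ C.ρ g),
    Function.Injective f → Function.Surjective g →
    LinearMap.range f = LinearMap.ker g →
    Function.Injective (coinvMap f hf.2) ∧
    LinearMap.range (coinvMap f hf.2) = LinearMap.ker (coinvMap g hg.2) ∧
    Function.Surjective (coinvMap g hg.2)

/-- Exactness of the coinvariants functor on the category of right `H`-comodules. -/
def CoinvExactComod : Prop :=
  ∀ (A B C : ComodCat k H) (f : A.V →ₗ[k] B.V) (g : B.V →ₗ[k] C.V)
    (hf : IsColin k H A.ρ B.ρ f) (hg : IsColin k H B.ρ C.ρ g),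
    Function.Injective f → Function.Surjective g →
    LinearMap.range f = LinearMap.ker g →
    Function.Injective (coinvMap f hf) ∧
    LinearMap.range (coinvMap f hf) = LinearMap.ker (coinvMap g hg) ∧
    Function.Surjective (coinvMap g hg)

section Eval

variable {k H}
variable {M N : Type} [AddCommGroup M] [Module k M] [Module H M]
  [IsScalarTower k H M] [SMulCommClass H k M]
  [AddCommGroup N] [Module k N] [Module H N] [IsScalarTower k H N] [SMulCommClass H k N]

/-- Evaluation at `m` of `H`-linear maps, as a `k`-linear map. -/
def evalAtH (m : M) : (M →ₗ[H] N) →ₗ[k] N where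
  toFun f := f m
  map_add' _ _ := rfl
  map_smul' _ _ := rfl

/-- Evaluation at `m` of `k`-linear maps, as a `k`-linear map. -/
def evalAtK {V : Type} [AddCommGroup V] [Module k V] (v : V) :
    (V →ₗ[k] N) →ₗ[k] N where
  toFun f := f v
  map_add' _ _ := rfl
  map_smul' _ _ := rfl

/-- Contraction `N ⊗ H → N` along a functional `φ : H → k`. -/
def contract (φ : H →ₗ[k] k) : N ⊗[k] H →ₗ[k] N :=
  (TensorProduct.rid k N).toLinearMap.comp (LinearMap.lTensor N φ)

/-- Post-composition with an `H`-linear map, as a `k`-linear map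
`Hom_H(X, M) → Hom_H(X, N)`; here `X` is the (implicit) source. -/
def postcompH {X : Type} [AddCommGroup X] [Module k X] [Module H X]
    [IsScalarTower k H X] [SMulCommClass H k X]
    (f : M →ₗ[k] N) (hf : ∀ (h : H) (m : M), f (h • m) = h • f m) :
    (X →ₗ[H] M) →ₗ[k] (X →ₗ[H] N) where
  toFun φ :=
    { toFun := fun x => f (φ x)
      map_add' := fun x y => by simp
      map_smul' := fun h x => by simp [hf] }
  map_add' φ ψ := by ext x; simp
  map_smul' c φ := by ext x; simp

end Eval

/-- Condition (†) for the category of Yetter-Drinfeld modules: for every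
Yetter-Drinfeld module `X` which is finitely generated as a left `H`-module,
the functor `Hom_H(X, -)` is exact on the category of Yetter-Drinfeld modules. -/
def DaggerYD (Sinv : H →ₗ[k] H) : Prop :=
  ∀ X : YDCat k H Sinv, Module.Finite H X.M →
  ∀ (A B C : YDCat k H Sinv) (f : A.M →ₗ[k] B.M) (g : B.M →ₗ[k] C.M)
    (hf : IsHom k H A.ρ B.ρ f) (hg : IsHom k H B.ρ C.ρ g),
    Function.Injective f → Function.Surjective g →
    LinearMap.range f = LinearMap.ker g →
    Function.Injective (postcompH (X := X.M) f hf.1) ∧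
    LinearMap.range (postcompH (X := X.M) f hf.1) =
      LinearMap.ker (postcompH (X := X.M) g hg.1) ∧
    Function.Surjective (postcompH (X := X.M) g hg.1)

/-- Condition (†) for the category of Long dimodules. -/
def DaggerLong : Prop :=
  ∀ X : LongCat k H, Module.Finite H X.M →
  ∀ (A B C : LongCat k H) (f : A.M →ₗ[k] B.M) (g : B.M →ₗ[k] C.M)
    (hf : IsHom k H A.ρ B.ρ f) (hg : IsHom k H B.ρ C.ρ g),
    Function.Injective f → Function.Surjective g →
    LinearMap.range f = LinearMap.ker g →
    Function.Injective (postcompH (X := X.M) f hf.1) ∧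
    LinearMap.range (postcompH (X := X.M) f hf.1) =
      LinearMap.ker (postcompH (X := X.M) g hg.1) ∧
    Function.Surjective (postcompH (X := X.M) g hg.1)

/-- Projective object in the category of Yetter-Drinfeld modules. -/
def IsProjectiveYD (Sinv : H →ₗ[k] H) (P : YDCat k H Sinv) : Prop :=
  ∀ (A B : YDCat k H Sinv) (g : A.M →ₗ[k] B.M) (f : P.M →ₗ[k] B.M),
    IsHom k H A.ρ B.ρ g → Function.Surjective g → IsHom k H P.ρ B.ρ f →
    ∃ l : P.M →ₗ[k] A.M, IsHom k H P.ρ A.ρ l ∧ g.comp l = f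

/-- Projective object in the category of Long dimodules. -/
def IsProjectiveLong (P : LongCat k H) : Prop :=
  ∀ (A B : LongCat k H) (g : A.M →ₗ[k] B.M) (f : P.M →ₗ[k] B.M),
    IsHom k H A.ρ B.ρ g → Function.Surjective g → IsHom k H P.ρ B.ρ f →
    ∃ l : P.M →ₗ[k] A.M, IsHom k H P.ρ A.ρ l ∧ g.comp l = f

/-- Injective object in the category of Yetter-Drinfeld modules. -/
def IsInjectiveYD (Sinv : H →ₗ[k] H) (I : YDCat k H Sinv) : Prop :=
  ∀ (A B : YDCat k H Sinv) (ι : A.M →ₗ[k] B.M) (f : A.M →ₗ[k] I.M),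
    IsHom k H A.ρ B.ρ ι → Function.Injective ι → IsHom k H A.ρ I.ρ f →
    ∃ g : B.M →ₗ[k] I.M, IsHom k H B.ρ I.ρ g ∧ g.comp ι = f

/-- Projective object in the category of right `H`-comodules. -/
def IsProjectiveComod (P : ComodCat k H) : Prop :=
  ∀ (A B : ComodCat k H) (g : A.V →ₗ[k] B.V) (f : P.V →ₗ[k] B.V),
    IsColin k H A.ρ B.ρ g → Function.Surjective g → IsColin k H P.ρ B.ρ f →
    ∃ l : P.V →ₗ[k] A.V, IsColin k H P.ρ A.ρ l ∧ g.comp l = f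

section HomLemmas

variable {k H}
variable {A B C : Type} [AddCommGroup A] [Module k A] [Module H A]
  [AddCommGroup B] [Module k B] [Module H B]
  [AddCommGroup C] [Module k C] [Module H C]

lemma IsHom.comp' {ρA : A →ₗ[k] A ⊗[k] H} {ρB : B →ₗ[k] B ⊗[k] H} {ρC : C →ₗ[k] C ⊗[k] H}
    {f : A →ₗ[k] B} {g : B →ₗ[k] C}
    (hf : IsHom k H ρA ρB f) (hg : IsHom k H ρB ρC g) :
    IsHom k H ρA ρC (g.comp f) := by
  refine ⟨fun h a => by simp [LinearMap.comp_apply, hf.1, hg.1], ?_⟩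
  calc ρC.comp (g.comp f) = (ρC.comp g).comp f := by rw [LinearMap.comp_assoc]
    _ = ((LinearMap.rTensor H g).comp ρB).comp f := by rw [hg.2]
    _ = (LinearMap.rTensor H g).comp (ρB.comp f) := by rw [LinearMap.comp_assoc]
    _ = (LinearMap.rTensor H g).comp ((LinearMap.rTensor H f).comp ρA) := by rw [hf.2]
    _ = ((LinearMap.rTensor H g).comp (LinearMap.rTensor H f)).comp ρA := by
          rw [LinearMap.comp_assoc]
    _ = (LinearMap.rTensor H (g.comp f)).comp ρA := by rw [LinearMap.rTensor_comp]

end HomLemmas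

section HomYD

variable {k H}
variable (Sinv : H →ₗ[k] H)

/-- The `k`-module of morphisms of Yetter-Drinfeld modules `Hom_H^H(A, B)`, as a
submodule of the `k`-linear maps. -/
def homYD (A B : YDCat k H Sinv) : Submodule k (A.M →ₗ[k] B.M) where
  carrier := {f | IsHom k H A.ρ B.ρ f}
  add_mem' := by
    rintro f g ⟨hf1, hf2⟩ ⟨hg1, hg2⟩
    refine ⟨fun h a => by simp [hf1, hg1, smul_add], ?_⟩
    rw [LinearMap.comp_add, LinearMap.rTensor_add, LinearMap.add_comp, hf2, hg2]
  zero_mem' := by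
    refine ⟨fun h a => by simp, ?_⟩
    rw [LinearMap.comp_zero, LinearMap.rTensor_zero, LinearMap.zero_comp]
  smul_mem' := by
    rintro c f ⟨hf1, hf2⟩
    refine ⟨fun h a => by
      rw [LinearMap.smul_apply, LinearMap.smul_apply, hf1, smul_comm], ?_⟩
    rw [LinearMap.comp_smul, LinearMap.rTensor_smul, LinearMap.smul_comp, hf2]

/-- Post-composition with a morphism of Yetter-Drinfeld modules, as a `k`-linear map
between morphism spaces. -/
def postcompYD {X B C : YDCat k H Sinv}
    (g : B.M →ₗ[k] C.M) (hg : IsHom k H B.ρ C.ρ g) :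
    ↥(homYD Sinv X B) →ₗ[k] ↥(homYD Sinv X C) where
  toFun f := ⟨g.comp f.1, IsHom.comp' f.2 hg⟩
  map_add' f g' := by ext x; simp
  map_smul' c f := by ext x; simp

/-- An injective resolution `0 → X → I⁰ → I¹ → ⋯` in the category of
Yetter-Drinfeld modules. -/
structure IsInjRes (X : YDCat k H Sinv) (I : ℕ → YDCat k H Sinv)
    (ε : X.M →ₗ[k] (I 0).M) (d : ∀ n, (I n).M →ₗ[k] (I (n + 1)).M) : Prop where
  eps_hom : IsHom k H X.ρ (I 0).ρ ε
  d_hom : ∀ n, IsHom k H (I n).ρ (I (n + 1)).ρ (d n)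
  inj : ∀ n, IsInjectiveYD k H Sinv (I n)
  mono : Function.Injective ε
  exact0 : LinearMap.range ε = LinearMap.ker (d 0)
  exact : ∀ n, LinearMap.range (d n) = LinearMap.ker (d (n + 1))

/-- A projective resolution `⋯ → P₁ → P₀ → X → 0` in the category of
Yetter-Drinfeld modules. -/
structure IsProjRes (X : YDCat k H Sinv) (P : ℕ → YDCat k H Sinv)
    (ε : (P 0).M →ₗ[k] X.M) (d : ∀ n, (P (n + 1)).M →ₗ[k] (P n).M) : Prop where
  eps_hom : IsHom k H (P 0).ρ X.ρ ε
  d_hom : ∀ n, IsHom k H (P (n + 1)).ρ (P n).ρ (d n)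
  proj : ∀ n, IsProjectiveYD k H Sinv (P n)
  epi : Function.Surjective ε
  exact0 : LinearMap.range (d 0) = LinearMap.ker ε
  exact : ∀ n, LinearMap.range (d (n + 1)) = LinearMap.ker (d n)

/-- The projective dimension of `X` in the category of Yetter-Drinfeld modules is
at most `n`. -/
def pdimLE (X : YDCat k H Sinv) (n : ℕ) : Prop :=
  ∃ (P : ℕ → YDCat k H Sinv) (ε : (P 0).M →ₗ[k] X.M)
    (d : ∀ m, (P (m + 1)).M →ₗ[k] (P m).M),
    IsProjRes Sinv X P ε d ∧ ∀ i, n < i → Subsingleton (P i).M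

/-- The injective dimension of `X` in the category of Yetter-Drinfeld modules is
at most `n`. -/
def injdimLE (X : YDCat k H Sinv) (n : ℕ) : Prop :=
  ∃ (I : ℕ → YDCat k H Sinv) (ε : X.M →ₗ[k] (I 0).M)
    (d : ∀ m, (I m).M →ₗ[k] (I (m + 1)).M),
    IsInjRes Sinv X I ε d ∧ ∀ i, n < i → Subsingleton (I i).M

/-- The complex `Hom(X, I⁰) → Hom(X, I¹) → ⋯` of morphism spaces induced by a
cochain of Yetter-Drinfeld modules. -/
def homCx (X : YDCat k H Sinv) (I : ℕ → YDCat k H Sinv)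
    (d : ∀ n, (I n).M →ₗ[k] (I (n + 1)).M)
    (hd : ∀ n, IsHom k H (I n).ρ (I (n + 1)).ρ (d n)) (n : ℕ) :
    ↥(homYD Sinv X (I n)) →ₗ[k] ↥(homYD Sinv X (I (n + 1))) :=
  postcompYD Sinv (d n) (hd n)

/-- Coboundaries of the induced complex. -/
def boundaries (X : YDCat k H Sinv) (I : ℕ → YDCat k H Sinv)
    (d : ∀ n, (I n).M →ₗ[k] (I (n + 1)).M)
    (hd : ∀ n, IsHom k H (I n).ρ (I (n + 1)).ρ (d n)) :
    ∀ i, Submodule k ↥(homYD Sinv X (I i))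
  | 0 => ⊥
  | (i + 1) => LinearMap.range (homCx Sinv X I d hd i)

/-- The `i`-th cohomology (cocycles modulo coboundaries) of the complex
`Hom(X, I⁰) → Hom(X, I¹) → ⋯`; when `I` is an injective resolution of `Y`, this is
`Ext^i(X, Y)`, the `i`-th right derived functor of `Hom_H^H(X, -)`, in the category
of Yetter-Drinfeld modules. -/
abbrev cohomology (X : YDCat k H Sinv) (I : ℕ → YDCat k H Sinv)
    (d : ∀ n, (I n).M →ₗ[k] (I (n + 1)).M)
    (hd : ∀ n, IsHom k H (I n).ρ (I (n + 1)).ρ (d n)) (i : ℕ) : Type :=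
  ↥(Submodule.map (boundaries Sinv X I d hd i).mkQ
      (LinearMap.ker (homCx Sinv X I d hd i)))

end HomYD

section CharProps

variable {k H}
variable (Sinv : H →ₗ[k] H)

/-- Characterizing property of the coaction on `Hom_H(A, B)` for Yetter-Drinfeld
modules `A`, `B`: it is determined by `f₀(m) ⊗ f₁ = f(m₀)₀ ⊗ f(m₀)₁ S(m₁)`. -/
def HomCoactChar (A B : YDCat k H Sinv)
    (ρQ : (A.M →ₗ[H] B.M) →ₗ[k] (A.M →ₗ[H] B.M) ⊗[k] H) : Prop :=
  ∀ (f : A.M →ₗ[H] B.M) (m : A.M) (t : Finset ℕ) (m₀ : ℕ → A.M) (m₁ : ℕ → H),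
    (∑ j ∈ t, m₀ j ⊗ₜ[k] m₁ j) = A.ρ m →
    (LinearMap.rTensor H (evalAtH (N := B.M) m)) (ρQ f) =
      ∑ j ∈ t, (LinearMap.lTensor B.M
          (LinearMap.mulRight k (HopfAlgebra.antipode (R := k) (A := H) (m₁ j))))
        (B.ρ (f (m₀ j)))

/-- Characterizing property of the coaction on `Hom_k(V, B)` for a comodule `V` and
a Yetter-Drinfeld module `B`: `g₀(v) ⊗ g₁ = g(v₀)₀ ⊗ g(v₀)₁ S(v₁)`. -/
def HomKCoactChar (V : ComodCat k H) (B : YDCat k H Sinv)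
    (ρ' : (V.V →ₗ[k] B.M) →ₗ[k] (V.V →ₗ[k] B.M) ⊗[k] H) : Prop :=
  ∀ (g : V.V →ₗ[k] B.M) (v : V.V) (t : Finset ℕ) (v₀ : ℕ → V.V) (v₁ : ℕ → H),
    (∑ j ∈ t, v₀ j ⊗ₜ[k] v₁ j) = V.ρ v →
    (LinearMap.rTensor H (evalAtK (N := B.M) v)) (ρ' g) =
      ∑ j ∈ t, (LinearMap.lTensor B.M
          (LinearMap.mulRight k (HopfAlgebra.antipode (R := k) (A := H) (v₁ j))))
        (B.ρ (g (v₀ j)))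

/-- Characterizing property of the Yetter-Drinfeld coaction on `H ⊗ V`:
`ρ(h ⊗ v) = h₂ ⊗ v₀ ⊗ h₃ v₁ S⁻¹(h₁)`. -/
def HTensorYDChar (V : ComodCat k H)
    (ρT : (H ⊗[k] V.V) →ₗ[k] (H ⊗[k] V.V) ⊗[k] H) : Prop :=
  ∀ (h : H) (v : V.V) (s t : Finset ℕ) (a b c : ℕ → H) (v₀ : ℕ → V.V) (v₁ : ℕ → H),
    (∑ i ∈ s, (a i ⊗ₜ[k] b i) ⊗ₜ[k] c i) = Delta2 k H h →
    (∑ j ∈ t, v₀ j ⊗ₜ[k] v₁ j) = V.ρ v →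
    ρT (h ⊗ₜ[k] v) =
      ∑ i ∈ s, ∑ j ∈ t, (b i ⊗ₜ[k] v₀ j) ⊗ₜ[k] (c i * v₁ j * Sinv (a i))

/-- Characterizing property of the Long dimodule coaction on `H ⊗ V`:
`ρ(h ⊗ v) = h ⊗ v₀ ⊗ v₁`. -/
def HTensorLongChar (V : ComodCat k H)
    (ρT : (H ⊗[k] V.V) →ₗ[k] (H ⊗[k] V.V) ⊗[k] H) : Prop :=
  ∀ (h : H) (v : V.V) (t : Finset ℕ) (v₀ : ℕ → V.V) (v₁ : ℕ → H),
    (∑ j ∈ t, v₀ j ⊗ₜ[k] v₁ j) = V.ρ v →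
    ρT (h ⊗ₜ[k] v) = ∑ j ∈ t, (h ⊗ₜ[k] v₀ j) ⊗ₜ[k] v₁ j

end CharProps

end RingPart

section CommPart

variable {k H : Type} [CommRing k] [CommRing H] [HopfAlgebra k H] (Sinv : H →ₗ[k] H)

/-- Characterizing property of the Yetter-Drinfeld coaction on `M ⊗_H N`:
`ρ(m ⊗ n) = m₀ ⊗ n₀ ⊗ n₁ m₁` (for `H` commutative). -/
def TensorCoactChar (A B : YDCat k H Sinv)
    (ρT : (A.M ⊗[H] B.M) →ₗ[k] (A.M ⊗[H] B.M) ⊗[k] H) : Prop :=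
  ∀ (m : A.M) (n : B.M) (s t : Finset ℕ) (m₀ : ℕ → A.M) (m₁ : ℕ → H)
    (n₀ : ℕ → B.M) (n₁ : ℕ → H),
    (∑ i ∈ s, m₀ i ⊗ₜ[k] m₁ i) = A.ρ m →
    (∑ j ∈ t, n₀ j ⊗ₜ[k] n₁ j) = B.ρ n →
    ρT (m ⊗ₜ[H] n) =
      ∑ i ∈ s, ∑ j ∈ t, (m₀ i ⊗ₜ[H] n₀ j) ⊗ₜ[k] (n₁ j * m₁ i)

/-- Restriction along `v ↦ 1 ⊗ v`, i.e. the canonical map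
`Hom_H(H ⊗ V, N) → Hom_k(V, N)`, `f ↦ (v ↦ f(1 ⊗ v))`. -/
def resUnitMap (V : Type) [AddCommGroup V] [Module k V] (N : Type) [AddCommGroup N]
    [Module k N] [Module H N] [IsScalarTower k H N] [SMulCommClass H k N] :
    ((H ⊗[k] V) →ₗ[H] N) →ₗ[k] (V →ₗ[k] N) where
  toFun f := (f.restrictScalars k).comp ((TensorProduct.mk k H V) 1)
  map_add' f g := by ext v; rfl
  map_smul' c f := by ext v; rfl

end CommPart

set_option linter.unusedSectionVars false

section Pf1
variable {k H : Type} [Field k] [CommRing H] [HopfAlgebra k H]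

lemma antipode_antipode_comm (h : H) :
    HopfAlgebra.antipode k (HopfAlgebra.antipode k h) = h := by
  have := inv_inv (WithConv.toConv (AlgHom.id k H))
  exact congrArg (fun f : WithConv (H →ₐ[k] H) => f.ofConv h) this

lemma sinv_eq (Sinv : H →ₗ[k] H)
    (hS1 : ∀ h : H, Sinv (HopfAlgebra.antipode (R := k) (A := H) h) = h) :
    Sinv = HopfAlgebra.antipode k := by
  ext h
  conv_lhs => rw [← antipode_antipode_comm (k := k) h]
  rw [hS1]

variable (k H) in
/-- first inclusion as a point -/
def px : WithConv (H →ₐ[k] H ⊗[k] H) := .toConv Algebra.TensorProduct.includeLeft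

variable (k H) in
/-- second inclusion as a point -/
def py : WithConv (H →ₐ[k] H ⊗[k] H) := .toConv Algebra.TensorProduct.includeRight

variable (k H) in
/-- coadjoint coaction -/
def adA : H →ₐ[k] H ⊗[k] H := ((py k H)⁻¹ * px k H * py k H).ofConv

variable (k H) in
/-- beta -/
def adB (T : H →ₗ[k] H) : (H ⊗[k] H) ⊗[k] H →ₗ[k] H ⊗[k] H :=
  TensorProduct.lift (TensorProduct.lift (LinearMap.mk₂ k
    (fun a b => LinearMap.lTensor H (LinearMap.mulRight k (T a)) ∘ₗ TensorProduct.mk k H H b)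
    (by intros; ext; simp [mul_add, tmul_add]) (by intros; ext; simp)
    (by intros; ext; simp) (by intros; ext; simp [smul_tmul'])))

@[simp] lemma adB_tmul (T : H →ₗ[k] H) (a b c : H) :
    adB k H T ((a ⊗ₜ b) ⊗ₜ c) = b ⊗ₜ (c * T a) := by
  simp [adB]

lemma adA_eq (h : H) : adA k H h = adB k H (HopfAlgebra.antipode k) (Delta2 k H h) := by
  have key : ∀ z : (H ⊗[k] H), 
    LinearMap.mul' k (H ⊗[k] H) (TensorProduct.map ((py k H)⁻¹ * px k H).ofConv.toLinearMap
      (py k H).ofConv.toLinearMap z)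
     = adB k H (HopfAlgebra.antipode k) (LinearMap.rTensor H (Coalgebra.comul (R := k) (A := H)) z) := by
    intro z
    induction z with
    | zero => simp
    | add x y hx hy => simp only [map_add, hx, hy]
    | tmul a b =>
      have key2 : ∀ w : (H ⊗[k] H), 
         LinearMap.mul' k (H ⊗[k] H) (TensorProduct.map ((py k H)⁻¹).ofConv.toLinearMap
          (px k H).ofConv.toLinearMap w) * (1 ⊗ₜ b)
          = adB k H (HopfAlgebra.antipode k) (w ⊗ₜ b) := by
        intro w
        induction w with
        | zero => simp
        | add x y hx hy => simp only [map_add, add_tmul, add_mul, hx, hy]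
        | tmul c d =>
          have : ((py k H)⁻¹).ofConv c = 1 ⊗ₜ HopfAlgebra.antipode k c := rfl
          have h2 : (px k H).ofConv d = d ⊗ₜ 1 := rfl
          simp [this, h2, mul_comm]
      have := key2 (Coalgebra.comul a)
      simp only [LinearMap.rTensor_tmul, ← this]
      rfl
  exact key _

variable (k H) in
/-- theta -/
def thetaA : H ⊗[k] H →ₐ[k] H ⊗[k] H :=
  Algebra.TensorProduct.lift (adA k H)
    (Algebra.TensorProduct.includeRight.comp (HopfAlgebra.antipodeAlgHom k H))
    (fun _ _ => Commute.all _ _)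

lemma grp_aux {G : Type} [Group G] (x y : G) : y * (y⁻¹ * x * y) * y⁻¹ = x := by group

lemma theta_ad (h : H) : thetaA k H (adA k H h) = h ⊗ₜ 1 := by
  have hx : WithConv.toConv ((thetaA k H).comp (px k H).ofConv)
      = (py k H)⁻¹ * px k H * py k H := by
    apply WithConv.ofConv_injective
    ext a
    simp [thetaA, px, adA]
  have hy : WithConv.toConv ((thetaA k H).comp (py k H).ofConv) = (py k H)⁻¹ := by
    apply WithConv.ofConv_injective
    apply AlgHom.ext
    intro a
    show thetaA k H (1 ⊗ₜ a) = 1 ⊗ₜ HopfAlgebra.antipode k a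
    simp [thetaA]
  have hyi : WithConv.toConv ((thetaA k H).comp ((py k H)⁻¹).ofConv) = (py k H) := by
    have := congrArg (·⁻¹) hy
    exact this.trans (inv_inv (py k H))
  have : WithConv.toConv ((thetaA k H).comp (adA k H)) = px k H := by
    have h1 := AlgHom.comp_convMul_distrib (thetaA k H) ((py k H)⁻¹ * px k H) (py k H)
    have h2 := AlgHom.comp_convMul_distrib (thetaA k H) ((py k H)⁻¹) (px k H)
    have h3 : WithConv.toConv ((thetaA k H).comp (adA k H)) =
       WithConv.toConv ((thetaA k H).comp ((py k H)⁻¹).ofConv) *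
       WithConv.toConv ((thetaA k H).comp (px k H).ofConv) *
       WithConv.toConv ((thetaA k H).comp (py k H).ofConv) := by
      apply WithConv.ofConv_injective
      show _ = _
      rw [adA]
      rw [h1, h2]
    rw [h3, hx, hy, hyi]; exact grp_aux (px k H) (py k H)
  exact congrArg (fun f : WithConv (H →ₐ[k] H ⊗[k] H) => f.ofConv h) this

end Pf1


section Pf2
variable {k H : Type} [Field k] [CommRing H] [HopfAlgebra k H]

lemma list_to_nat {ι X : Type} [AddCommMonoid X] (e : ι) (F : ι → X) (l : List ι) :
    ∃ (s : Finset ℕ) (u : ℕ → ι), ∑ j ∈ s, F (u j) = (l.map F).sum := by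
  refine ⟨Finset.range l.length, fun j => l.getD j e, ?_⟩
  induction l with
  | nil => simp
  | cons a l ih => 
    rw [List.length_cons, Finset.sum_range_succ', List.map_cons, List.sum_cons, ← ih, add_comm]
    simp

lemma exists_nat_sum {A B : Type} [AddCommGroup A] [Module k A] [AddCommGroup B] [Module k B]
    (x : A ⊗[k] B) : ∃ (t : Finset ℕ) (a : ℕ → A) (b : ℕ → B), ∑ j ∈ t, a j ⊗ₜ[k] b j = x := by
  have h : ∃ l : List (A × B), (l.map (fun p => p.1 ⊗ₜ[k] p.2)).sum = x := by
    induction x with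
    | zero => exact ⟨[], rfl⟩
    | tmul a b => exact ⟨[(a, b)], by simp⟩
    | add x y hx hy =>
      obtain ⟨l, rfl⟩ := hx
      obtain ⟨l', rfl⟩ := hy
      exact ⟨l ++ l', by simp⟩
  obtain ⟨l, hl⟩ := h
  obtain ⟨s, u, h⟩ := list_to_nat (0, 0) (fun p : A × B => p.1 ⊗ₜ[k] p.2) l
  exact ⟨s, fun j => (u j).1, fun j => (u j).2, h.trans hl⟩

lemma exists_nat_sum3 (x : (H ⊗[k] H) ⊗[k] H) : ∃ (t : Finset ℕ) (a b c : ℕ → H),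
    ∑ j ∈ t, (a j ⊗ₜ[k] b j) ⊗ₜ[k] c j = x := by
  have h : ∃ l : List (H × H × H), (l.map (fun p => (p.1 ⊗ₜ[k] p.2.1) ⊗ₜ[k] p.2.2)).sum = x := by
    induction x with
    | zero => exact ⟨[], rfl⟩
    | tmul a b =>
      induction a with
      | zero => exact ⟨[], by simp⟩
      | tmul a c => exact ⟨[(a, c, b)], by simp⟩
      | add x y hx hy =>
        obtain ⟨l, hl⟩ := hx
        obtain ⟨l', hl'⟩ := hy
        exact ⟨l ++ l', by simp [hl, hl', add_tmul]⟩
    | add x y hx hy =>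
      obtain ⟨l, rfl⟩ := hx
      obtain ⟨l', rfl⟩ := hy
      exact ⟨l ++ l', by simp⟩
  obtain ⟨l, hl⟩ := h
  obtain ⟨s, u, h⟩ := list_to_nat (0, 0, 0) (fun p : H × H × H => (p.1 ⊗ₜ[k] p.2.1) ⊗ₜ[k] p.2.2) l
  exact ⟨s, fun j => (u j).1, fun j => (u j).2.1, fun j => (u j).2.2, h.trans hl⟩

section act
variable (k H) (M : Type) [AddCommGroup M] [Module k M] [Module H M] [IsScalarTower k H M]

/-- The action of `H ⊗ H` on `M ⊗ H`. -/
def act : H ⊗[k] H →ₐ[k] Module.End k (M ⊗[k] H) :=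
  (Module.endTensorEndAlgHom (R := k) (A := k) (M := M) (N := H)).comp
    (Algebra.TensorProduct.map (Algebra.lsmul k k M) (Algebra.lmul k H))

variable {k H M}
@[simp] lemma act_tmul (a b c : H) (m : M) :
    act k H M (a ⊗ₜ b) (m ⊗ₜ c) = (a • m) ⊗ₜ (b * c) := rfl

lemma act_tmul' (a b : H) (x : M ⊗[k] H) :
    act k H M (a ⊗ₜ b) x = TensorProduct.map (Algebra.lsmul k k M a) (Algebra.lmul k H b) x := rfl

end act

variable {M : Type} [AddCommGroup M] [Module k M] [Module H M] [IsScalarTower k H M]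

lemma yd_rhs (T : H →ₗ[k] H) (s t : Finset ℕ) (a b c : ℕ → H) (m₀ : ℕ → M) (m₁ : ℕ → H) :
    act k H M (adB k H T (∑ i ∈ s, (a i ⊗ₜ[k] b i) ⊗ₜ[k] c i)) (∑ j ∈ t, m₀ j ⊗ₜ[k] m₁ j)
    = ∑ i ∈ s, ∑ j ∈ t, (b i • m₀ j) ⊗ₜ[k] (c i * m₁ j * T (a i)) := by
  simp only [map_sum, adB_tmul, LinearMap.sum_apply, act_tmul]
  rw [Finset.sum_comm]
  refine Finset.sum_congr rfl fun i _ => Finset.sum_congr rfl fun j _ => ?_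
  rw [mul_right_comm]

/-- The Yetter-Drinfeld condition in closed form. -/
lemma isYDCompat_iff (ρ : M →ₗ[k] M ⊗[k] H) :
    IsYDCompat k H (HopfAlgebra.antipode k) ρ ↔
      ∀ (h : H) (m : M), ρ (h • m) = act k H M (adA k H h) (ρ m) := by
  constructor
  · intro hy h m
    obtain ⟨s, a, b, c, h1⟩ := exists_nat_sum3 (Delta2 k H h)
    obtain ⟨t, m0, m1, h2⟩ := exists_nat_sum (ρ m)
    rw [hy h m s t a b c m0 m1 h1 h2, adA_eq, ← h1, ← h2, yd_rhs]
  · intro hy h m s t a b c m0 m1 h1 h2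
    rw [hy, adA_eq, ← h1, ← h2, yd_rhs]

lemma comod_S (ρ : M →ₗ[k] M ⊗[k] H) (hρ : IsComod k H ρ) (n : M) :
    LinearMap.lTensor M (LinearMap.mul' k H ∘ₗ LinearMap.lTensor H (HopfAlgebra.antipode k))
      (TensorProduct.assoc k M H H (LinearMap.rTensor H ρ (ρ n))) = n ⊗ₜ 1 := by
  rw [hρ.2, ← LinearMap.comp_apply, ← LinearMap.lTensor_comp]
  have : (LinearMap.mul' k H ∘ₗ LinearMap.lTensor H (HopfAlgebra.antipode k)) ∘ₗ
      Coalgebra.comul (R := k) (A := H) = Algebra.linearMap k H ∘ₗ Coalgebra.counit := by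
    ext; simp
  rw [this]
  conv_rhs => rw [← hρ.1 n]
  generalize ρ n = x
  induction x with
  | zero => simp
  | add x y hx hy => simp only [map_add, hx, hy, add_tmul]
  | tmul a b => simp [Algebra.algebraMap_eq_smul_one, smul_tmul]

lemma comod_S' (ρ : M →ₗ[k] M ⊗[k] H) (hρ : IsComod k H ρ) (n : M) :
    LinearMap.lTensor M (LinearMap.mul' k H ∘ₗ LinearMap.rTensor H (HopfAlgebra.antipode k))
      (TensorProduct.assoc k M H H (LinearMap.rTensor H ρ (ρ n))) = n ⊗ₜ 1 := by
  rw [hρ.2, ← LinearMap.comp_apply, ← LinearMap.lTensor_comp]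
  have : (LinearMap.mul' k H ∘ₗ LinearMap.rTensor H (HopfAlgebra.antipode k)) ∘ₗ
      Coalgebra.comul (R := k) (A := H) = Algebra.linearMap k H ∘ₗ Coalgebra.counit := by
    ext; simp
  rw [this]
  conv_rhs => rw [← hρ.1 n]
  generalize ρ n = x
  induction x with
  | zero => simp
  | add x y hx hy => simp only [map_add, hx, hy, add_tmul]
  | tmul a b => simp [Algebra.algebraMap_eq_smul_one, smul_tmul]

end Pf2


section Pf3
variable {k H : Type} [Field k] [CommRing H] [HopfAlgebra k H]

variable (k H) in
/-- Yetter-Drinfeld modules with respect to the antipode. -/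
abbrev YD := YDCat k H (HopfAlgebra.antipode k)

lemma YDCat.smul_coact (A : YD k H) (h : H) (m : A.M) :
    A.ρ (h • m) = act k H A.M (adA k H h) (A.ρ m) :=
  (isYDCompat_iff A.ρ).1 A.compat h m

section tens
variable (A B : Type) [AddCommGroup A] [Module k A] [Module H A] [IsScalarTower k H A]
  [SMulCommClass H k A]
  [AddCommGroup B] [Module k B] [Module H B] [IsScalarTower k H B] [SMulCommClass H k B]
  (W : Type) [CommRing W] [Algebra k W]

variable (k H) in
/-- The `k`-bilinear canonical map. -/
def mkH : A →ₗ[k] B →ₗ[k] A ⊗[H] B :=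
  LinearMap.mk₂ k (fun a b => a ⊗ₜ[H] b) (fun _ _ _ => add_tmul _ _ _)
    (fun _ _ _ => rfl) (fun _ _ _ => tmul_add _ _ _) (fun _ _ _ => tmul_smul _ _ _)

variable {A B} in
@[simp] lemma mkH_apply (a : A) (b : B) : mkH k H A B a b = a ⊗ₜ[H] b := rfl

variable (k H) in
/-- `(a ⊗ v, b ⊗ w) ↦ (a ⊗ b) ⊗ vw`. -/
def Om : A ⊗[k] W →ₗ[k] B ⊗[k] W →ₗ[k] (A ⊗[H] B) ⊗[k] W :=
  TensorProduct.map₂ (mkH k H A B) (LinearMap.mul k W)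

variable {A B W}
@[simp] lemma Om_tmul (a : A) (b : B) (v w : W) :
    Om k H A B W (a ⊗ₜ v) (b ⊗ₜ w) = (a ⊗ₜ b) ⊗ₜ (v * w) := rfl

lemma Om_act_left (z : H ⊗[k] H) (x : A ⊗[k] H) (y : B ⊗[k] H) :
    Om k H A B H (act k H A z x) y = act k H (A ⊗[H] B) z (Om k H A B H x y) := by
  induction z with
  | zero => simp
  | add u v hu hv => simp only [map_add, LinearMap.add_apply, hu, hv]
  | tmul a b =>
  induction x with
  | zero => simp
  | add u v hu hv => simp only [map_add, LinearMap.add_apply, hu, hv]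
  | tmul m c =>
  induction y with
  | zero => simp
  | add u v hu hv => simp only [map_add, hu, hv]
  | tmul n d => simp [smul_tmul', mul_assoc]

lemma Om_act_right (z : H ⊗[k] H) (x : A ⊗[k] H) (y : B ⊗[k] H) :
    Om k H A B H x (act k H B z y) = act k H (A ⊗[H] B) z (Om k H A B H x y) := by
  induction z with
  | zero => simp
  | add u v hu hv => simp only [map_add, LinearMap.add_apply, hu, hv]
  | tmul a b =>
  induction x with
  | zero => simp
  | add u v hu hv => simp only [map_add, LinearMap.add_apply, hu, hv]
  | tmul m c =>
  induction y with
  | zero => simp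
  | add u v hu hv => simp only [map_add, hu, hv]
  | tmul n d => simp [smul_tmul', mul_left_comm]

end tens

/-- closed form characterization of the coaction on the tensor product. -/
def IsTC (A B : YD k H) (ρT : (A.M ⊗[H] B.M) →ₗ[k] (A.M ⊗[H] B.M) ⊗[k] H) : Prop :=
  ∀ m n, ρT (m ⊗ₜ n) = Om k H A.M B.M H (A.ρ m) (B.ρ n)

lemma isTC_of_char (A B : YD k H) (ρT : (A.M ⊗[H] B.M) →ₗ[k] (A.M ⊗[H] B.M) ⊗[k] H)
    (h : TensorCoactChar _ A B ρT) : IsTC A B ρT := by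
  intro m n
  obtain ⟨s, m0, m1, h1⟩ := exists_nat_sum (A.ρ m)
  obtain ⟨t, n0, n1, h2⟩ := exists_nat_sum (B.ρ n)
  rw [h m n s t m0 m1 n0 n1 h1 h2, ← h1, ← h2]
  simp only [map_sum, LinearMap.sum_apply, Om_tmul]
  rw [Finset.sum_comm]
  simp only [mul_comm]

/-- The coaction on the tensor product. -/
def rhoT (A B : YD k H) : (A.M ⊗[H] B.M) →ₗ[k] (A.M ⊗[H] B.M) ⊗[k] H where
  toFun := TensorProduct.liftAddHom
    (AddMonoidHom.mk' (fun m => AddMonoidHom.mk' (fun n => Om k H A.M B.M H (A.ρ m) (B.ρ n))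
      (by intros; simp)) (by intros; ext; simp)) (by
        intro h m n
        simp only [AddMonoidHom.mk'_apply]
        rw [A.smul_coact, B.smul_coact, Om_act_left, Om_act_right])
  map_add' := map_add _
  map_smul' c x := by
    induction x with
    | zero => simp
    | add u v hu hv => simp only [smul_add, map_add, hu, hv]
    | tmul m n => simp [smul_tmul']

lemma rhoT_tc (A B : YD k H) : IsTC A B (rhoT A B) := fun _ _ => rfl

section
variable (A B : YD k H) (ρT : (A.M ⊗[H] B.M) →ₗ[k] (A.M ⊗[H] B.M) ⊗[k] H)
lemma IsTC.counit (hT : IsTC A B ρT) (x : A.M ⊗[H] B.M) : (TensorProduct.rid k _)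
      ((LinearMap.lTensor _ (Coalgebra.counit (R := k) (A := H))) (ρT x)) = x := by
  have key : ∀ (x : A.M ⊗[k] H) (y : B.M ⊗[k] H),
    (TensorProduct.rid k _)
      ((LinearMap.lTensor _ (Coalgebra.counit (R := k) (A := H))) (Om k H A.M B.M H x y)) =
    (TensorProduct.rid k _) ((LinearMap.lTensor _ (Coalgebra.counit (R := k) (A := H))) x) ⊗ₜ[H]
    (TensorProduct.rid k _) ((LinearMap.lTensor _ (Coalgebra.counit (R := k) (A := H))) y) := by
    intro x y
    induction x with
    | zero => simp
    | add u v hu hv => simp only [map_add, LinearMap.add_apply, hu, hv, add_tmul]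
    | tmul m c =>
    induction y with
    | zero => simp
    | add u v hu hv => simp only [map_add, hu, hv, tmul_add]
    | tmul n d =>
      simp only [Om_tmul, LinearMap.lTensor_tmul, TensorProduct.rid_tmul, Bialgebra.counit_mul]
      rw [tmul_smul, ← smul_tmul', smul_smul, mul_comm]
  induction x with
  | zero => simp
  | add u v hu hv => simp only [map_add, hu, hv]
  | tmul m n => rw [hT, key, A.comod.1, B.comod.1]

lemma IsTC.coassoc (hT : IsTC A B ρT) (x : A.M ⊗[H] B.M) :
    (TensorProduct.assoc k _ H H) ((LinearMap.rTensor H ρT) (ρT x)) =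
      (LinearMap.lTensor _ (Coalgebra.comul (R := k) (A := H))) (ρT x) := by
  have key1 : ∀ (x : A.M ⊗[k] H) (y : B.M ⊗[k] H),
    (LinearMap.lTensor _ (Coalgebra.comul (R := k) (A := H))) (Om k H A.M B.M H x y) =
      Om k H A.M B.M (H ⊗[k] H) ((LinearMap.lTensor _ (Coalgebra.comul (R := k) (A := H))) x)
        ((LinearMap.lTensor _ (Coalgebra.comul (R := k) (A := H))) y) := by
    intro x y
    induction x with
    | zero => simp
    | add u v hu hv => simp only [map_add, LinearMap.add_apply, hu, hv]
    | tmul m c =>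
    induction y with
    | zero => simp
    | add u v hu hv => simp only [map_add, hu, hv]
    | tmul n d => simp
  have key2 : ∀ (x : A.M ⊗[k] H) (y : B.M ⊗[k] H),
    (TensorProduct.assoc k _ H H) ((LinearMap.rTensor H ρT) (Om k H A.M B.M H x y)) =
      Om k H A.M B.M (H ⊗[k] H) (TensorProduct.assoc k _ H H (LinearMap.rTensor H A.ρ x))
        (TensorProduct.assoc k _ H H (LinearMap.rTensor H B.ρ y)) := by
    intro x y
    induction x with
    | zero => simp
    | add u v hu hv => simp only [map_add, LinearMap.add_apply, hu, hv]
    | tmul m c =>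
    induction y with
    | zero => simp
    | add u v hu hv => simp only [map_add, hu, hv]
    | tmul n d =>
      simp only [Om_tmul, LinearMap.rTensor_tmul, hT m n]
      generalize A.ρ m = x
      generalize B.ρ n = y
      induction x with
      | zero => simp
      | add u v hu hv => simp only [map_add, add_tmul, LinearMap.add_apply, hu, hv]
      | tmul m c =>
      induction y with
      | zero => simp
      | add u v hu hv => simp only [map_add, add_tmul, hu, hv]
      | tmul n d => simp
  induction x with
  | zero => simp
  | add u v hu hv => simp only [map_add, hu, hv]
  | tmul m n => rw [hT, key1, key2, A.comod.2, B.comod.2]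

lemma IsTC.smul (hT : IsTC A B ρT) (h : H) (x : A.M ⊗[H] B.M) :
    ρT (h • x) = act k H _ (adA k H h) (ρT x) := by
  induction x with
  | zero => simp
  | add u v hu hv => simp only [smul_add, map_add, hu, hv]
  | tmul m n => rw [smul_tmul', hT, hT, A.smul_coact, Om_act_left]

end

/-- The Yetter-Drinfeld module `A ⊗_H B`. -/
abbrev tens (A B : YD k H) : YD k H :=
  YDCat.mk (M := A.M ⊗[H] B.M) (rhoT A B) ⟨(rhoT_tc A B).counit, (rhoT_tc A B).coassoc⟩
    ((isYDCompat_iff _).2 (rhoT_tc A B).smul)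

end Pf3


section Pf4
variable {k H : Type} [Field k] [CommRing H] [HopfAlgebra k H]

section hom
variable (N Q : Type) [AddCommGroup N] [Module k N] [Module H N] [IsScalarTower k H N]
  [SMulCommClass H k N]
  [AddCommGroup Q] [Module k Q] [Module H Q] [IsScalarTower k H Q] [SMulCommClass H k Q]
  (W : Type) [CommRing W] [Algebra k W]

variable (k H) in
/-- Evaluation, as a bilinear map. -/
def evB : N →ₗ[k] (N →ₗ[H] Q) →ₗ[k] Q :=
  LinearMap.mk₂ k (fun n f => f n) (fun _ _ f => map_add f _ _)
    (fun c n f => by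
      show f (c • n) = c • f n
      rw [← algebraMap_smul H c n, map_smul, algebraMap_smul]) (fun _ _ _ => rfl) (fun _ _ _ => rfl)

variable (k H) in
/-- Contraction. -/
def Cn : N ⊗[k] W →ₗ[k] (N →ₗ[H] Q) ⊗[k] W →ₗ[k] Q ⊗[k] W :=
  TensorProduct.map₂ (evB k H N Q) (LinearMap.mul k W)

variable {N Q W}
@[simp] lemma Cn_tmul (n : N) (f : N →ₗ[H] Q) (v w : W) :
    Cn k H N Q W (n ⊗ₜ v) (f ⊗ₜ w) = f n ⊗ₜ (v * w) := rfl

lemma Cn_one (n : N) (y : (N →ₗ[H] Q) ⊗[k] W) :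
    Cn k H N Q W (n ⊗ₜ 1) y = LinearMap.rTensor W (evalAtH (k := k) (N := Q) n) y := by
  induction y with
  | zero => simp
  | add u v hu hv => simp only [map_add, hu, hv]
  | tmul f w => simp [evalAtH]

lemma Cn_act (z : H ⊗[k] H) (x : N ⊗[k] H) (y : (N →ₗ[H] Q) ⊗[k] H) :
    Cn k H N Q H x (act k H _ z y) = act k H Q z (Cn k H N Q H x y) := by
  induction z with
  | zero => simp
  | add u v hu hv => simp only [map_add, LinearMap.add_apply, hu, hv]
  | tmul a b =>
  induction x with
  | zero => simp
  | add u v hu hv => simp only [map_add, LinearMap.add_apply, hu, hv]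
  | tmul m c =>
  induction y with
  | zero => simp
  | add u v hu hv => simp only [map_add, hu, hv]
  | tmul n d => simp [mul_left_comm]

lemma Cn_smul (n : N) (h : H) (y : (N →ₗ[H] Q) ⊗[k] H) :
    Cn k H N Q H (n ⊗ₜ h) y = act k H Q (1 ⊗ₜ h) (Cn k H N Q H (n ⊗ₜ 1) y) := by
  induction y with
  | zero => simp
  | add u v hu hv => simp only [map_add, hu, hv]
  | tmul n d => simp

lemma dual_basis (N : Type) [AddCommGroup N] [Module H N] [Module.Finite H N]
    [Module.Projective H N] : ∃ (r : ℕ) (e : Fin r → N) (φ : Fin r → (N →ₗ[H] H)),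
      ∀ n, ∑ i, φ i n • e i = n := by
  obtain ⟨r, f, g, -, -, hfg⟩ := Module.Finite.exists_comp_eq_id_of_projective H N
  refine ⟨r, fun i => f (Pi.single i 1), fun i => (LinearMap.proj i) ∘ₗ g, fun n => ?_⟩
  have h1 : f (g n) = n := congrArg (fun t : N →ₗ[H] N => t n) hfg
  conv_rhs => rw [← h1, LinearMap.pi_apply_eq_sum_univ f (g n)]
  refine Finset.sum_congr rfl fun i _ => ?_
  have : (Pi.single i 1 : Fin r → H) = fun j => if i = j then 1 else 0 := by
    ext j
    simp [Pi.single_apply, eq_comm]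
  simp only [this]
  rfl

/-- `q ↦ φ(-) q`. -/
def toHomK (φ : N →ₗ[H] H) : Q →ₗ[k] (N →ₗ[H] Q) where
  toFun q := φ.smulRight q
  map_add' _ _ := by ext; simp
  map_smul' c q := by ext n; exact smul_comm (φ n) c q

lemma Cn_toHomK (φ : N →ₗ[H] H) (n : N) (q : Q ⊗[k] H) :
    Cn k H N Q H (n ⊗ₜ 1) (LinearMap.rTensor H (toHomK φ) q) = act k H Q (φ n ⊗ₜ 1) q := by
  induction q with
  | zero => simp
  | add u v hu hv => simp only [map_add, hu, hv]
  | tmul f w => simp [toHomK]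

lemma hom_ext_aux [Module.Finite H N] [Module.Projective H N] (y : (N →ₗ[H] Q) ⊗[k] W)
    (h : ∀ n, Cn k H N Q W (n ⊗ₜ 1) y = 0) : y = 0 := by
  obtain ⟨r, e, φ, he⟩ := dual_basis (H := H) N
  have h1 : (∑ i, toHomK (φ i) ∘ₗ evalAtH (k := k) (N := Q) (e i)) = LinearMap.id := by
    ext f n
    simp only [LinearMap.sum_apply, LinearMap.comp_apply, LinearMap.id_apply]
    conv_rhs => rw [← he n]
    simp [toHomK, evalAtH]
  have h2 : LinearMap.rTensor W (∑ i, toHomK (φ i) ∘ₗ evalAtH (k := k) (N := Q) (e i)) y = y := by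
    rw [h1]; simp
  rw [← h2]
  simp only [← LinearMap.coe_rTensorHom, map_sum, LinearMap.sum_apply]
  refine Finset.sum_eq_zero fun i _ => ?_
  rw [LinearMap.coe_rTensorHom, LinearMap.rTensor_comp, LinearMap.comp_apply, ← Cn_one, h, map_zero]

lemma E_inj [Module.Finite H N] [Module.Projective H N] (ρ : N →ₗ[k] N ⊗[k] H)
    (hρ : IsComod k H ρ) (δ : H →ₐ[k] W) (y y' : (N →ₗ[H] Q) ⊗[k] W)
    (h : ∀ n, Cn k H N Q W (LinearMap.lTensor N δ.toLinearMap (ρ n)) y =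
      Cn k H N Q W (LinearMap.lTensor N δ.toLinearMap (ρ n)) y') : y = y' := by
  rw [← sub_eq_zero]
  generalize hw : y - y' = w
  have h0 : ∀ n, Cn k H N Q W (LinearMap.lTensor N δ.toLinearMap (ρ n)) w = 0 := by
    intro n; rw [← hw, map_sub, h, sub_self]
  clear hw h
  apply hom_ext_aux
  intro n
  have key1 : ∀ (u : N ⊗[k] H) (h : H), Cn k H N Q W (LinearMap.lTensor N δ.toLinearMap
      (LinearMap.lTensor N
      (LinearMap.mul' k H ∘ₗ LinearMap.lTensor H (HopfAlgebra.antipode k))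
        (TensorProduct.assoc k N H H (u ⊗ₜ h)))) w =
        LinearMap.lTensor Q (LinearMap.mulLeft k (δ (HopfAlgebra.antipode k h)))
        (Cn k H N Q W (LinearMap.lTensor N δ.toLinearMap u) w) := by
    clear h0
    intro u h
    induction u with
    | zero => simp
    | add u v hu hv => simp only [map_add, add_tmul, LinearMap.add_apply, hu, hv]
    | tmul m c =>
    induction w with
    | zero => simp
    | add u v hu hv => simp only [map_add, hu, hv]
    | tmul n d => simp [mul_left_comm, mul_assoc]
  have key2 : ∀ z : N ⊗[k] H, Cn k H N Q W (LinearMap.lTensor N δ.toLinearMap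
      (LinearMap.lTensor N
      (LinearMap.mul' k H ∘ₗ LinearMap.lTensor H (HopfAlgebra.antipode k))
        (TensorProduct.assoc k N H H (LinearMap.rTensor H ρ z)))) w = 0 := by
    intro z
    induction z with
    | zero => simp
    | add u v hu hv => simp only [map_add, LinearMap.add_apply, hu, hv, add_zero]
    | tmul m c => rw [LinearMap.rTensor_tmul, key1, h0, map_zero]
  have := key2 (ρ n)
  rw [comod_S ρ hρ] at this
  simpa using this

end hom

/-- `n ⊗ h ↦ h · ρ(f n)`. -/
def Ph (N Q : YD k H) (f : N.M →ₗ[H] Q.M) : N.M ⊗[k] H →ₗ[k] Q.M ⊗[k] H :=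
  TensorProduct.lift (LinearMap.mk₂ k (fun n h => act k H Q.M (1 ⊗ₜ h) (Q.ρ (f n)))
    (by intros; simp) (by
      intro c n h
      have : f (c • n) = c • f n := by
        rw [← algebraMap_smul H c n, map_smul, algebraMap_smul]
      rw [this]; simp)
    (by intros; simp [tmul_add]) (by intros; simp))

@[simp] lemma Ph_tmul (N Q : YD k H) (f : N.M →ₗ[H] Q.M) (n : N.M) (h : H) :
    Ph N Q f (n ⊗ₜ h) = act k H Q.M (1 ⊗ₜ h) (Q.ρ (f n)) := rfl

lemma Ph_act (N Q : YD k H) (f : N.M →ₗ[H] Q.M) (z : H ⊗[k] H) (t : N.M ⊗[k] H) :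
    Ph N Q f (LinearMap.lTensor _ (HopfAlgebra.antipode k) (act k H N.M z t)) =
      act k H Q.M (thetaA k H z)
        (Ph N Q f (LinearMap.lTensor _ (HopfAlgebra.antipode k) t)) := by
  induction z with
  | zero => simp
  | add u v hu hv => simp only [map_add, LinearMap.add_apply, hu, hv]
  | tmul a b =>
  induction t with
  | zero => simp
  | add u v hu hv => simp only [map_add, hu, hv]
  | tmul m c =>
    simp only [act_tmul, LinearMap.lTensor_tmul, Ph_tmul, map_smul, Q.smul_coact,
      ← Module.End.mul_apply, ← map_mul]
    congr 2
    simp only [thetaA, Algebra.TensorProduct.lift_tmul]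
    have h1 : ((1 : H) ⊗ₜ[k] HopfAlgebra.antipode k (b * c) : H ⊗[k] H) =
      (1 ⊗ₜ HopfAlgebra.antipode k b) * (1 ⊗ₜ HopfAlgebra.antipode k c) := by
      rw [Algebra.TensorProduct.tmul_mul_tmul, HopfAlgebra.antipode_mul_distrib, one_mul]
    rw [h1]
    show _ = adA k H a * (1 ⊗ₜ HopfAlgebra.antipode k b) * (1 ⊗ₜ HopfAlgebra.antipode k c)
    ring

lemma Ph_smul (N Q : YD k H) (f : N.M →ₗ[H] Q.M) (h : H) (n : N.M) :
    Ph N Q f (LinearMap.lTensor _ (HopfAlgebra.antipode k) (N.ρ (h • n))) =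
      act k H Q.M (h ⊗ₜ 1)
        (Ph N Q f (LinearMap.lTensor _ (HopfAlgebra.antipode k) (N.ρ n))) := by
  rw [N.smul_coact, Ph_act, theta_ad]

lemma Cn_of_Ph (N Q : YD k H) (f : N.M →ₗ[H] Q.M) (x : (N.M →ₗ[H] Q.M) ⊗[k] H)
    (hx : ∀ n, Cn k H N.M Q.M H (n ⊗ₜ 1) x =
      Ph N Q f (LinearMap.lTensor _ (HopfAlgebra.antipode k) (N.ρ n))) (n : N.M) :
    Cn k H N.M Q.M H (N.ρ n) x = Q.ρ (f n) := by
  have key1 : ∀ (u : N.M ⊗[k] H) (h : H),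
      act k H Q.M (1 ⊗ₜ h) (Ph N Q f (LinearMap.lTensor _ (HopfAlgebra.antipode k) u)) =
      Ph N Q f (LinearMap.lTensor _
        (LinearMap.mul' k H ∘ₗ LinearMap.rTensor H (HopfAlgebra.antipode k))
        (TensorProduct.assoc k _ H H (u ⊗ₜ h))) := by
    intro u h
    induction u with
    | zero => simp
    | add u v hu hv => simp only [map_add, add_tmul, hu, hv]
    | tmul m c =>
      simp [← Module.End.mul_apply, ← map_mul, mul_comm]
  have key2 : ∀ z : N.M ⊗[k] H, Cn k H N.M Q.M H z x =
      Ph N Q f (LinearMap.lTensor _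
        (LinearMap.mul' k H ∘ₗ LinearMap.rTensor H (HopfAlgebra.antipode k))
        (TensorProduct.assoc k _ H H (LinearMap.rTensor H N.ρ z))) := by
    intro z
    induction z with
    | zero => simp
    | add u v hu hv => simp only [map_add, LinearMap.add_apply, hu, hv]
    | tmul m h => rw [Cn_smul, hx, key1, LinearMap.rTensor_tmul]
  rw [key2, comod_S' _ N.comod, Ph_tmul, ← Algebra.TensorProduct.one_def, map_one,
    Module.End.one_apply]

/-- closed form characterization of the coaction on `Hom_H(N, Q)`. -/
def IsRC (N Q : YD k H) (ρR : (N.M →ₗ[H] Q.M) →ₗ[k] (N.M →ₗ[H] Q.M) ⊗[k] H) : Prop :=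
  ∀ f n, Cn k H N.M Q.M H (N.ρ n) (ρR f) = Q.ρ (f n)

lemma isRC_of_char (N Q : YD k H) (ρR : (N.M →ₗ[H] Q.M) →ₗ[k] (N.M →ₗ[H] Q.M) ⊗[k] H)
    (h : HomCoactChar _ N Q ρR) : IsRC N Q ρR := by
  intro f n
  apply Cn_of_Ph
  intro n
  obtain ⟨t, n0, n1, h2⟩ := exists_nat_sum (N.ρ n)
  rw [Cn_one, h f n t n0 n1 h2, ← h2]
  simp only [map_sum, LinearMap.lTensor_tmul, Ph_tmul]
  refine Finset.sum_congr rfl fun j _ => ?_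
  generalize Q.ρ (f (n0 j)) = x
  induction x with
  | zero => simp
  | add u v hu hv => simp only [map_add, hu, hv]
  | tmul m h => simp [mul_comm]

section fgp
variable (N Q : YD k H) [Module.Finite H N.M] [Module.Projective H N.M]

lemma E_inj' (y y' : (N.M →ₗ[H] Q.M) ⊗[k] H)
    (h : ∀ n, Cn k H N.M Q.M H (N.ρ n) y = Cn k H N.M Q.M H (N.ρ n) y') : y = y' := by
  apply E_inj N.ρ N.comod (AlgHom.id k H)
  intro n
  simpa using h n

lemma exists_RC (f : N.M →ₗ[H] Q.M) : ∃ x : (N.M →ₗ[H] Q.M) ⊗[k] H,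
    ∀ n, Cn k H N.M Q.M H (N.ρ n) x = Q.ρ (f n) := by
  obtain ⟨r, e, φ, he⟩ := dual_basis (H := H) N.M
  refine ⟨∑ i, LinearMap.rTensor H (toHomK (φ i))
    (Ph N Q f (LinearMap.lTensor _ (HopfAlgebra.antipode k) (N.ρ (e i)))), ?_⟩
  apply Cn_of_Ph
  intro n
  conv_rhs => rw [← he n]
  simp only [map_sum, Cn_toHomK, Ph_smul]

/-- The coaction on `Hom_H(N, Q)`. -/
def rhoR : (N.M →ₗ[H] Q.M) →ₗ[k] (N.M →ₗ[H] Q.M) ⊗[k] H where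
  toFun f := (exists_RC N Q f).choose
  map_add' f g := by
    apply E_inj'
    intro n
    rw [map_add, (exists_RC N Q (f + g)).choose_spec, (exists_RC N Q f).choose_spec,
      (exists_RC N Q g).choose_spec, LinearMap.add_apply, map_add]
  map_smul' c f := by
    apply E_inj'
    intro n
    rw [map_smul, (exists_RC N Q (c • f)).choose_spec, RingHom.id_apply,
      (exists_RC N Q f).choose_spec, LinearMap.smul_apply, map_smul]

lemma rhoR_rc : IsRC N Q (rhoR N Q) := fun f => (exists_RC N Q f).choose_spec

variable {N Q} {ρR : (N.M →ₗ[H] Q.M) →ₗ[k] (N.M →ₗ[H] Q.M) ⊗[k] H}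

lemma IsRC.counit (hR : IsRC N Q ρR) (f : N.M →ₗ[H] Q.M) : (TensorProduct.rid k _)
      ((LinearMap.lTensor _ (Coalgebra.counit (R := k) (A := H))) (ρR f)) = f := by
  have key : ∀ (z : N.M ⊗[k] H) (y : (N.M →ₗ[H] Q.M) ⊗[k] H),
    (TensorProduct.rid k _)
      ((LinearMap.lTensor _ (Coalgebra.counit (R := k) (A := H))) (Cn k H N.M Q.M H z y)) =
    ((TensorProduct.rid k _) ((LinearMap.lTensor _ (Coalgebra.counit (R := k) (A := H))) y) :
      N.M →ₗ[H] Q.M)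
    ((TensorProduct.rid k _) ((LinearMap.lTensor _ (Coalgebra.counit (R := k) (A := H))) z)) := by
    intro x y
    induction x with
    | zero => simp
    | add u v hu hv => simp only [map_add, LinearMap.add_apply, hu, hv]
    | tmul m c =>
    induction y with
    | zero => simp
    | add u v hu hv => simp only [map_add, hu, hv, LinearMap.add_apply]
    | tmul n d =>
      simp only [Cn_tmul, LinearMap.lTensor_tmul, TensorProduct.rid_tmul, Bialgebra.counit_mul,
        LinearMap.smul_apply]
      have h1 : n (Coalgebra.counit (R := k) c • m) = Coalgebra.counit (R := k) c • n m := by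
        rw [← algebraMap_smul H (Coalgebra.counit (R := k) c) m, map_smul, algebraMap_smul]
      rw [h1, smul_smul, mul_comm]
  ext n
  have := key (N.ρ n) (ρR f)
  rw [hR, Q.comod.1, N.comod.1] at this
  exact this.symm

lemma IsRC.coassoc (hR : IsRC N Q ρR) (f : N.M →ₗ[H] Q.M) :
    (TensorProduct.assoc k _ H H) ((LinearMap.rTensor H ρR) (ρR f)) =
      (LinearMap.lTensor _ (Coalgebra.comul (R := k) (A := H))) (ρR f) := by
  have key1 : ∀ (x : N.M ⊗[k] H) (y : (N.M →ₗ[H] Q.M) ⊗[k] H),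
    (LinearMap.lTensor _ (Coalgebra.comul (R := k) (A := H))) (Cn k H N.M Q.M H x y) =
      Cn k H N.M Q.M (H ⊗[k] H) ((LinearMap.lTensor _ (Coalgebra.comul (R := k) (A := H))) x)
        ((LinearMap.lTensor _ (Coalgebra.comul (R := k) (A := H))) y) := by
    intro x y
    induction x with
    | zero => simp
    | add u v hu hv => simp only [map_add, LinearMap.add_apply, hu, hv]
    | tmul m c =>
    induction y with
    | zero => simp
    | add u v hu hv => simp only [map_add, hu, hv]
    | tmul n d => simp
  have key2 : ∀ (x : N.M ⊗[k] H) (y : (N.M →ₗ[H] Q.M) ⊗[k] H),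
    (TensorProduct.assoc k _ H H) ((LinearMap.rTensor H Q.ρ) (Cn k H N.M Q.M H x y)) =
      Cn k H N.M Q.M (H ⊗[k] H) (TensorProduct.assoc k _ H H (LinearMap.rTensor H N.ρ x))
        (TensorProduct.assoc k _ H H (LinearMap.rTensor H ρR y)) := by
    intro x y
    induction x with
    | zero => simp
    | add u v hu hv => simp only [map_add, LinearMap.add_apply, hu, hv]
    | tmul m c =>
    induction y with
    | zero => simp
    | add u v hu hv => simp only [map_add, hu, hv]
    | tmul g d =>
      simp only [Cn_tmul, LinearMap.rTensor_tmul, ← hR g m]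
      generalize N.ρ m = x
      generalize ρR g = y
      induction x with
      | zero => simp
      | add u v hu hv => simp only [map_add, add_tmul, LinearMap.add_apply, hu, hv]
      | tmul m c =>
      induction y with
      | zero => simp
      | add u v hu hv => simp only [map_add, add_tmul, hu, hv]
      | tmul n d => simp
  apply E_inj N.ρ N.comod (Bialgebra.comulAlgHom k H)
  intro n
  have e : (Bialgebra.comulAlgHom k H).toLinearMap = Coalgebra.comul (R := k) (A := H) := rfl
  rw [e, ← key1, hR, ← N.comod.2, ← key2, hR, Q.comod.2]

lemma IsRC.smul (hR : IsRC N Q ρR) (h : H) (f : N.M →ₗ[H] Q.M) :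
    ρR (h • f) = act k H _ (adA k H h) (ρR f) := by
  apply E_inj'
  intro n
  rw [hR, Cn_act, hR, LinearMap.smul_apply, Q.smul_coact]

end fgp

/-- The Yetter-Drinfeld module `Hom_H(N, Q)`. -/
abbrev homR (N Q : YD k H) [Module.Finite H N.M] [Module.Projective H N.M] : YD k H :=
  YDCat.mk (M := N.M →ₗ[H] Q.M) (rhoR N Q) ⟨(rhoR_rc N Q).counit, (rhoR_rc N Q).coassoc⟩
    ((isYDCompat_iff _).2 (rhoR_rc N Q).smul)

end Pf4


section Pf5
variable {k H : Type} [Field k] [CommRing H] [HopfAlgebra k H]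

/-- A `k`-linear map commuting with `H` as an `H`-linear map. -/
def toH {A B : Type} [AddCommGroup A] [Module k A] [Module H A]
    [AddCommGroup B] [Module k B] [Module H B] (f : A →ₗ[k] B)
    (hf : ∀ (h : H) (a : A), f (h • a) = h • f a) : A →ₗ[H] B where
  toFun := f
  map_add' := map_add f
  map_smul' := hf

lemma IsHom.apply {A B : Type} [AddCommGroup A] [Module k A] [Module H A]
    [AddCommGroup B] [Module k B] [Module H B] {ρA : A →ₗ[k] A ⊗[k] H} {ρB : B →ₗ[k] B ⊗[k] H}
    {f : A →ₗ[k] B} (hf : IsHom k H ρA ρB f) (a : A) :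
    ρB (f a) = LinearMap.rTensor H f (ρA a) :=
  congrArg (fun g : A →ₗ[k] B ⊗[k] H => g a) hf.2

section adj
variable {A N Q : YD k H}

/-- currying -/
def curryK (f : A.M ⊗[H] N.M →ₗ[k] Q.M) (hf : ∀ (h : H) x, f (h • x) = h • f x) :
    A.M →ₗ[k] (N.M →ₗ[H] Q.M) where
  toFun a :=
    { toFun := fun n => f (a ⊗ₜ n)
      map_add' := fun x y => by rw [tmul_add, map_add]
      map_smul' := fun h x => by rw [tmul_smul, hf, RingHom.id_apply] }
  map_add' a b := by ext n; simp [add_tmul]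
  map_smul' c a := by ext n; simp [← smul_tmul']

/-- uncurrying -/
def uncurryK (g : A.M →ₗ[k] (N.M →ₗ[H] Q.M)) (hg : ∀ (h : H) x, g (h • x) = h • g x) :
    A.M ⊗[H] N.M →ₗ[k] Q.M :=
  (TensorProduct.lift (toH g hg)).restrictScalars k

@[simp] lemma curryK_apply (f : A.M ⊗[H] N.M →ₗ[k] Q.M) (hf : ∀ (h : H) x, f (h • x) = h • f x)
    (a : A.M) (n : N.M) : curryK f hf a n = f (a ⊗ₜ n) := rfl

@[simp] lemma uncurryK_tmul (g : A.M →ₗ[k] (N.M →ₗ[H] Q.M))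
    (hg : ∀ (h : H) x, g (h • x) = h • g x) (a : A.M) (n : N.M) :
    uncurryK g hg (a ⊗ₜ n) = g a n := rfl

lemma Om_Cn (f : A.M ⊗[H] N.M →ₗ[k] Q.M) (g : A.M →ₗ[k] (N.M →ₗ[H] Q.M))
    (hfg : ∀ a n, f (a ⊗ₜ n) = g a n) (x : A.M ⊗[k] H) (y : N.M ⊗[k] H) :
    LinearMap.rTensor H f (Om k H A.M N.M H x y) =
      Cn k H N.M Q.M H y (LinearMap.rTensor H g x) := by
  induction x with
  | zero => simp
  | add u v hu hv => simp only [map_add, LinearMap.add_apply, hu, hv]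
  | tmul m c =>
  induction y with
  | zero => simp
  | add u v hu hv => simp only [map_add, LinearMap.add_apply, hu, hv]
  | tmul n d => simp [hfg, mul_comm]

variable [Module.Finite H N.M] [Module.Projective H N.M]

lemma curryK_isHom (f : A.M ⊗[H] N.M →ₗ[k] Q.M) (hf : IsHom k H (tens A N).ρ Q.ρ f) :
    IsHom k H A.ρ (homR N Q).ρ (curryK f hf.1) := by
  constructor
  · intro h a
    ext n
    show f ((h • a) ⊗ₜ n) = h • f (a ⊗ₜ n)
    rw [← hf.1, smul_tmul']
  · ext1 a
    apply E_inj'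
    intro n
    show Cn k H N.M Q.M H (N.ρ n) (rhoR N Q (curryK f hf.1 a)) = _
    rw [rhoR_rc, LinearMap.comp_apply, ← Om_Cn f _ (fun _ _ => rfl), curryK_apply, hf.apply]
    rfl

lemma uncurryK_isHom (g : A.M →ₗ[k] (N.M →ₗ[H] Q.M)) (hg : IsHom k H A.ρ (homR N Q).ρ g) :
    IsHom k H (tens A N).ρ Q.ρ (uncurryK g hg.1) := by
  constructor
  · intro h a
    exact map_smul (TensorProduct.lift (toH g hg.1)) h a
  · ext1 x
    simp only [LinearMap.comp_apply]
    refine TensorProduct.induction_on x (by simp) (fun m n => ?_) (fun u v hu hv => ?_)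
    · rw [uncurryK_tmul]
      show _ = LinearMap.rTensor H (uncurryK g hg.1) (Om k H A.M N.M H (A.ρ m) (N.ρ n))
      rw [Om_Cn _ g (fun _ _ => rfl), ← hg.apply, ← rhoR_rc]
    · have h1 := map_add (uncurryK g hg.1) u v
      have h2 := map_add (tens A N).ρ u v
      rw [h1, h2, map_add, map_add, hu, hv]

variable (A N Q) in
/-- The adjunction. -/
def adjF : ↥(homYD _ (tens A N) Q) →ₗ[k] ↥(homYD _ A (homR N Q)) where
  toFun f := ⟨curryK f.1 f.2.1, curryK_isHom f.1 f.2⟩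
  map_add' _ _ := rfl
  map_smul' _ _ := rfl

variable (A N Q) in
/-- The adjunction, inverse. -/
def adjG : ↥(homYD _ A (homR N Q)) →ₗ[k] ↥(homYD _ (tens A N) Q) where
  toFun g := ⟨uncurryK g.1 g.2.1, uncurryK_isHom g.1 g.2⟩
  map_add' f g := by
    apply Subtype.ext
    apply LinearMap.ext
    intro x
    exact TensorProduct.induction_on (motive := fun x => uncurryK (f + g).1 (f + g).2.1 x =
      (uncurryK f.1 f.2.1 + uncurryK g.1 g.2.1) x) x (by simp) (fun m n => rfl)
      (fun u v hu hv => by rw [map_add, map_add, hu, hv])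
  map_smul' c f := by
    apply Subtype.ext
    apply LinearMap.ext
    intro x
    exact TensorProduct.induction_on (motive := fun x => uncurryK (c • f).1 (c • f).2.1 x =
      (c • uncurryK f.1 f.2.1) x) x (by simp) (fun m n => rfl)
      (fun u v hu hv => by rw [map_add, map_add, hu, hv])

lemma adjF_adjG (g) : adjF A N Q (adjG A N Q g) = g := rfl

lemma adjG_adjF (f) : adjG A N Q (adjF A N Q f) = f := by
  apply Subtype.ext
  apply LinearMap.ext
  intro x
  exact TensorProduct.induction_on (motive := fun x => (adjG A N Q (adjF A N Q f)).1 x = f.1 x) x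
      (by rw [map_zero, map_zero]) (fun m n => rfl)
      (fun u v hu hv => by rw [map_add, map_add, hu, hv])

variable (N) in
/-- Functoriality of `Hom_H(N, -)`. -/
abbrev Rmap {Q Q' : YD k H} (d : Q.M →ₗ[k] Q'.M) (hd : IsHom k H Q.ρ Q'.ρ d) :
    (homR N Q).M →ₗ[k] (homR N Q').M := postcompH (X := N.M) d hd.1

lemma Rmap_isHom {Q Q' : YD k H} (d : Q.M →ₗ[k] Q'.M) (hd : IsHom k H Q.ρ Q'.ρ d) :
    IsHom k H (homR N Q).ρ (homR N Q').ρ (Rmap N d hd) := by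
  constructor
  · intro h f
    ext n
    exact hd.1 h (f n)
  · ext1 f
    apply E_inj'
    intro n
    show Cn k H N.M Q'.M H (N.ρ n) (rhoR N Q' (Rmap N d hd f)) =
      Cn k H N.M Q'.M H (N.ρ n) (LinearMap.rTensor H (Rmap N d hd) (rhoR N Q f))
    have key : ∀ (z : N.M ⊗[k] H) (y : (N.M →ₗ[H] Q.M) ⊗[k] H),
      Cn k H N.M Q'.M H z (LinearMap.rTensor H (Rmap N d hd) y) =
        LinearMap.rTensor H d (Cn k H N.M Q.M H z y) := by
      intro x y
      induction x with
      | zero => simp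
      | add u v hu hv => simp only [map_add, LinearMap.add_apply, hu, hv]
      | tmul m c =>
      induction y with
      | zero => simp
      | add u v hu hv => simp only [map_add, hu, hv]
      | tmul n d => simp [Rmap, postcompH]
    rw [key, rhoR_rc, rhoR_rc, ← hd.apply]
    rfl

lemma homR_injective (hQ : IsInjectiveYD k H _ Q) : IsInjectiveYD k H _ (homR N Q) := by
  intro A B ι f hι hinj hf
  let ι' : (tens A N).M →ₗ[k] (tens B N).M :=
    (LinearMap.rTensor N.M (toH ι hι.1)).restrictScalars k
  have hι' : IsHom k H (tens A N).ρ (tens B N).ρ ι' := by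
    constructor
    · intro h x
      exact map_smul (LinearMap.rTensor N.M (toH ι hι.1)) h x
    · have key : ∀ (x : A.M ⊗[k] H) (y : N.M ⊗[k] H), 
        Om k H B.M N.M H (LinearMap.rTensor H ι x) y =
          LinearMap.rTensor H ι' (Om k H A.M N.M H x y) := by
        intro x y
        induction x with
        | zero => simp
        | add u v hu hv => simp only [map_add, LinearMap.add_apply, hu, hv]
        | tmul m c =>
        induction y with
        | zero => simp
        | add u v hu hv => simp only [map_add, hu, hv]
        | tmul n d => simp [ι', toH]
      apply LinearMap.ext
      intro x
      simp only [LinearMap.comp_apply]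
      refine TensorProduct.induction_on x (by simp) (fun m n => ?_) (fun u v hu hv => ?_)
      · show Om k H B.M N.M H (B.ρ (ι m)) (N.ρ n) =
          LinearMap.rTensor H ι' (Om k H A.M N.M H (A.ρ m) (N.ρ n))
        rw [hι.apply, key]
      · have h1 := map_add ι' u v
        have h2 := map_add (tens A N).ρ u v
        rw [h1, h2, map_add, map_add, hu, hv]
  have hι'inj : Function.Injective ι' :=
    Module.Flat.rTensor_preserves_injective_linearMap (M := N.M) (toH ι hι.1) hinj
  obtain ⟨g, hg, hgf⟩ := hQ (tens A N) (tens B N) ι' (uncurryK f hf.1) hι' hι'inj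
    (uncurryK_isHom f hf)
  refine ⟨curryK g hg.1, curryK_isHom g hg, ?_⟩
  apply LinearMap.ext
  intro a
  apply LinearMap.ext
  intro n
  exact congrArg (fun t : A.M ⊗[H] N.M →ₗ[k] Q.M => t (a ⊗ₜ n)) hgf

lemma Rmap_exact {Q Q' Q'' : YD k H} (d : Q.M →ₗ[k] Q'.M) (hd : IsHom k H Q.ρ Q'.ρ d)
    (d' : Q'.M →ₗ[k] Q''.M) (hd' : IsHom k H Q'.ρ Q''.ρ d')
    (h : LinearMap.range d = LinearMap.ker d') :
    LinearMap.range (Rmap N d hd) = LinearMap.ker (Rmap N d' hd') := by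
  apply le_antisymm
  · rintro _ ⟨f, rfl⟩
    rw [LinearMap.mem_ker]
    apply LinearMap.ext
    intro n
    have : d (f n) ∈ LinearMap.ker d' := h ▸ LinearMap.mem_range_self d _
    exact this
  · intro g hg
    have hg' : ∀ n, g n ∈ LinearMap.range (toH d hd.1) := by
      intro n
      have h1 : g n ∈ LinearMap.ker d' :=
        congrArg (fun t : N.M →ₗ[H] Q''.M => t n) (LinearMap.mem_ker.1 hg)
      rw [← h] at h1
      exact h1
    obtain ⟨l, hl⟩ := Module.projective_lifting_property (toH d hd.1).rangeRestrict
      (LinearMap.codRestrict _ g hg') (LinearMap.surjective_rangeRestrict _)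
    refine ⟨l, ?_⟩
    apply LinearMap.ext
    intro n
    exact congrArg (fun t : N.M →ₗ[H] LinearMap.range (toH d hd.1) => (t n).1) hl

lemma Rmap_inj {Q Q' : YD k H} (d : Q.M →ₗ[k] Q'.M) (hd : IsHom k H Q.ρ Q'.ρ d)
    (h : Function.Injective d) : Function.Injective (Rmap N d hd) := by
  intro f g hfg
  apply LinearMap.ext
  intro n
  exact h (congrArg (fun t : N.M →ₗ[H] Q'.M => t n) hfg)

lemma homR_injRes {P : YD k H} {J : ℕ → YD k H} {ε' : P.M →ₗ[k] (J 0).M}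
    {dJ : ∀ n, (J n).M →ₗ[k] (J (n + 1)).M} (hJ : IsInjRes _ P J ε' dJ) :
    IsInjRes _ (homR N P) (fun n => homR N (J n)) (Rmap N ε' hJ.eps_hom)
      (fun n => Rmap N (dJ n) (hJ.d_hom n)) where
  eps_hom := Rmap_isHom _ _
  d_hom n := Rmap_isHom _ _
  inj n := homR_injective (hJ.inj n)
  mono := Rmap_inj _ _ hJ.mono
  exact0 := Rmap_exact _ _ _ _ hJ.exact0
  exact n := Rmap_exact _ _ _ _ (hJ.exact n)

end adj

end Pf5


section Pf6
variable {k H : Type} [Field k] [CommRing H] [HopfAlgebra k H]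

section sub
variable {X : Type} [AddCommGroup X] [Module k X] [Module H X] [IsScalarTower k H X]
  [SMulCommClass H k X]

lemma rTensor_inj_field (W : Type) [AddCommGroup W] [Module k W] {Y : Type} [AddCommGroup Y]
    [Module k Y] (i : X →ₗ[k] Y) (hi : Function.Injective i) :
    Function.Injective (LinearMap.rTensor W i) :=
  Module.Flat.rTensor_preserves_injective_linearMap (M := W) i hi

/-- Transport of the coaction to a stable submodule. -/
def subRho (B : YD k H) (i : X →ₗ[k] B.M) (hi : Function.Injective i)
    (hr : ∀ x, B.ρ (i x) ∈ LinearMap.range (LinearMap.rTensor H i)) : X →ₗ[k] X ⊗[k] H :=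
  (LinearEquiv.ofInjective _ (rTensor_inj_field H i hi)).symm.toLinearMap.comp
    (LinearMap.codRestrict _ (B.ρ.comp i) hr)

lemma subRho_spec (B : YD k H) (i : X →ₗ[k] B.M) (hi : Function.Injective i)
    (hr : ∀ x, B.ρ (i x) ∈ LinearMap.range (LinearMap.rTensor H i)) (x : X) :
    LinearMap.rTensor H i (subRho B i hi hr x) = B.ρ (i x) := by
  have := (LinearEquiv.ofInjective _ (rTensor_inj_field H i hi)).apply_symm_apply
    (LinearMap.codRestrict _ (B.ρ.comp i) hr x)
  exact congrArg Subtype.val this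

lemma sub_comod (B : YD k H) (i : X →ₗ[k] B.M) (hi : Function.Injective i)
    (ρ : X →ₗ[k] X ⊗[k] H) (hρ : ∀ x, LinearMap.rTensor H i (ρ x) = B.ρ (i x)) :
    IsComod k H ρ := by
  constructor
  · intro x
    apply hi
    have h1 : ∀ y : X ⊗[k] H, i ((TensorProduct.rid k X)
      ((LinearMap.lTensor X (Coalgebra.counit (R := k) (A := H))) y)) =
        (TensorProduct.rid k B.M)
      ((LinearMap.lTensor B.M (Coalgebra.counit (R := k) (A := H))) (LinearMap.rTensor H i y)) := by
      intro y
      induction y with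
      | zero => simp
      | add u v hu hv => simp only [map_add, hu, hv]
      | tmul a b => simp
    rw [h1, hρ, B.comod.1]
  · intro x
    apply rTensor_inj_field (H ⊗[k] H) i hi
    have h1 : ∀ y : (X ⊗[k] H) ⊗[k] H, LinearMap.rTensor (H ⊗[k] H) i
      ((TensorProduct.assoc k X H H) y) = (TensorProduct.assoc k B.M H H)
        (LinearMap.rTensor H (LinearMap.rTensor H i) y) := by
      intro y
      induction y with
      | zero => simp
      | add u v hu hv => simp only [map_add, hu, hv]
      | tmul a b =>
      induction a with
      | zero => simp
      | add u v hu hv => simp only [map_add, add_tmul, hu, hv]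
      | tmul a c => simp
    have h2 : (LinearMap.rTensor H i).comp ρ = B.ρ.comp i := LinearMap.ext hρ
    have h3 : ∀ y : X ⊗[k] H, LinearMap.rTensor (H ⊗[k] H) i
      (LinearMap.lTensor X (Coalgebra.comul (R := k) (A := H)) y) =
       LinearMap.lTensor B.M (Coalgebra.comul (R := k) (A := H)) (LinearMap.rTensor H i y) := by
      intro y
      induction y with
      | zero => simp
      | add u v hu hv => simp only [map_add, hu, hv]
      | tmul a b => simp
    rw [h1, h3, hρ, ← B.comod.2, ← LinearMap.comp_apply (LinearMap.rTensor H _),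
      ← LinearMap.rTensor_comp, h2, LinearMap.rTensor_comp, LinearMap.comp_apply, hρ]

lemma sub_compat (B : YD k H) (i : X →ₗ[k] B.M) (hi : Function.Injective i)
    (hiH : ∀ (h : H) x, i (h • x) = h • i x)
    (ρ : X →ₗ[k] X ⊗[k] H) (hρ : ∀ x, LinearMap.rTensor H i (ρ x) = B.ρ (i x)) :
    IsYDCompat k H (HopfAlgebra.antipode k) ρ := by
  rw [isYDCompat_iff]
  intro h m
  apply rTensor_inj_field H i hi
  have h1 : ∀ (z : H ⊗[k] H) (y : X ⊗[k] H), LinearMap.rTensor H i (act k H X z y) =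
      act k H B.M z (LinearMap.rTensor H i y) := by
    intro z y
    induction z with
    | zero => simp
    | add u v hu hv => simp only [map_add, LinearMap.add_apply, hu, hv]
    | tmul a b =>
    induction y with
    | zero => simp
    | add u v hu hv => simp only [map_add, hu, hv]
    | tmul n d => simp [hiH]
  rw [h1, hρ, hρ, hiH, (isYDCompat_iff B.ρ).1 B.compat]

end sub

lemma inj_extend {A B I : YD k H} (hI : IsInjectiveYD k H _ I) (u : A.M →ₗ[k] B.M)
    (hu : IsHom k H A.ρ B.ρ u) (f : A.M →ₗ[k] I.M) (hf : IsHom k H A.ρ I.ρ f)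
    (hk : ∀ x, u x = 0 → f x = 0) :
    ∃ g : B.M →ₗ[k] I.M, IsHom k H B.ρ I.ρ g ∧ ∀ x, g (u x) = f x := by
  let R : Submodule H B.M := LinearMap.range (toH u hu.1)
  let X : Type := ↥R
  let i : X →ₗ[k] B.M := R.subtype.restrictScalars k
  have hi : Function.Injective i := Subtype.val_injective
  let u' : A.M →ₗ[k] X := (toH u hu.1).rangeRestrict.restrictScalars k
  have hu's : Function.Surjective u' := LinearMap.surjective_rangeRestrict (toH u hu.1)
  have hiu : i.comp u' = u := rfl
  have hr : ∀ x, B.ρ (i x) ∈ LinearMap.range (LinearMap.rTensor H i) := by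
    intro x
    obtain ⟨a, rfl⟩ := hu's x
    refine ⟨LinearMap.rTensor H u' (A.ρ a), ?_⟩
    rw [← LinearMap.comp_apply, ← LinearMap.rTensor_comp, hiu, ← hu.apply]
    rfl
  let XX : YD k H := YDCat.mk (M := X) (subRho B i hi hr) (sub_comod B i hi _ (subRho_spec B i hi hr))
    (sub_compat B i hi (fun _ _ => rfl) _ (subRho_spec B i hi hr))
  have hiHom : IsHom k H XX.ρ B.ρ i :=
    ⟨fun _ _ => rfl, LinearMap.ext fun x => (subRho_spec B i hi hr x).symm⟩
  have hu'c : ∀ a, XX.ρ (u' a) = LinearMap.rTensor H u' (A.ρ a) := by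
    intro a
    apply rTensor_inj_field H i hi
    rw [← hiHom.apply, ← LinearMap.comp_apply (LinearMap.rTensor H i), ← LinearMap.rTensor_comp,
      hiu, ← hu.apply]
    rfl
  obtain ⟨s, hs⟩ := u'.exists_rightInverse_of_surjective (LinearMap.range_eq_top.2 hu's)
  have hs' : ∀ x, u' (s x) = x := fun x => congrArg (fun t : X →ₗ[k] X => t x) hs
  let fb : XX.M →ₗ[k] I.M := f.comp s
  have hfb : ∀ a, fb (u' a) = f a := by
    intro a
    show f (s (u' a)) = f a
    rw [← sub_eq_zero, ← map_sub]
    apply hk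
    have : u' (s (u' a) - a) = 0 := by rw [map_sub, hs', sub_self]
    exact congrArg Subtype.val this
  have hfb' : fb.comp u' = f := LinearMap.ext hfb
  have hfbHom : IsHom k H XX.ρ I.ρ fb := by
    constructor
    · intro h x
      obtain ⟨a, rfl⟩ := hu's x
      have : h • u' a = u' (h • a) := (map_smul (toH u hu.1).rangeRestrict h a).symm
      have h2 : fb (h • u' a) = fb (u' (h • a)) := congrArg fb this
      rw [h2, hfb, hfb, hf.1]
    · apply LinearMap.ext
      intro x
      obtain ⟨a, rfl⟩ := hu's x
      show I.ρ (fb (u' a)) = LinearMap.rTensor H fb (XX.ρ (u' a))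
      rw [hfb, hu'c, ← LinearMap.comp_apply (LinearMap.rTensor H fb), ← LinearMap.rTensor_comp, hfb', hf.apply]
  obtain ⟨g, hg, hgf⟩ := hI XX B i fb hiHom hi hfbHom
  refine ⟨g, hg, fun x => ?_⟩
  rw [← hfb x, ← hgf]
  rfl

end Pf6


section Pf7
variable {k H : Type} [Field k] [CommRing H] [HopfAlgebra k H]

lemma dep_rec {T : ℕ → Type} (R : ∀ n, T n → T (n + 1) → Prop) (t0 : T 0)
    (h : ∀ n t, ∃ t', R n t t') : ∃ f : ∀ n, T n, f 0 = t0 ∧ ∀ n, R n (f n) (f (n + 1)) := by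
  choose g hg using h
  exact ⟨fun n => Nat.rec t0 (fun n t => g n t) n, rfl, fun n => hg n _⟩

section chain
variable {X : YD k H} {I K : ℕ → YD k H} {ε : X.M →ₗ[k] (I 0).M} {ε' : X.M →ₗ[k] (K 0).M}
  {d : ∀ n, (I n).M →ₗ[k] (I (n + 1)).M} {d' : ∀ n, (K n).M →ₗ[k] (K (n + 1)).M}

lemma IsInjRes.ex (hI : IsInjRes _ X I ε d) (n : ℕ) (x : (I (n + 1)).M) (hx : d (n + 1) x = 0) :
    ∃ y, d n y = x := by
  have : x ∈ LinearMap.ker (d (n + 1)) := hx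
  rw [← hI.exact] at this
  exact this

lemma IsInjRes.ex0 (hI : IsInjRes _ X I ε d) (x : (I 0).M) (hx : d 0 x = 0) :
    ∃ y, ε y = x := by
  have : x ∈ LinearMap.ker (d 0) := hx
  rw [← hI.exact0] at this
  exact this

lemma IsInjRes.dd (hI : IsInjRes _ X I ε d) (n : ℕ) (x : (I n).M) : d (n + 1) (d n x) = 0 := by
  have : d n x ∈ LinearMap.range (d n) := ⟨x, rfl⟩
  rw [hI.exact] at this
  exact this

lemma IsInjRes.de (hI : IsInjRes _ X I ε d) (x : X.M) : d 0 (ε x) = 0 := by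
  have : ε x ∈ LinearMap.range ε := ⟨x, rfl⟩
  rw [hI.exact0] at this
  exact this

lemma chain_map (hI : IsInjRes _ X I ε d) (hK : IsInjRes _ X K ε' d') :
    ∃ φ : ∀ n, (I n).M →ₗ[k] (K n).M, (∀ n, IsHom k H (I n).ρ (K n).ρ (φ n)) ∧
      (∀ x, φ 0 (ε x) = ε' x) ∧ ∀ n x, φ (n + 1) (d n x) = d' n (φ n x) := by
  obtain ⟨φ0, h0, h0e⟩ := inj_extend (hK.inj 0) ε hI.eps_hom ε' hK.eps_hom (fun x hx => by
    have : x = 0 := hI.mono (by rw [hx, map_zero])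
    rw [this, map_zero])
  let T : ℕ → Type := fun n => {φ : (I n).M →ₗ[k] (K n).M // IsHom k H (I n).ρ (K n).ρ φ ∧
    ∀ x, d n x = 0 → d' n (φ x) = 0}
  obtain ⟨f, hf0, hf⟩ := dep_rec (T := T) (fun n φ ψ => ∀ x, ψ.1 (d n x) = d' n (φ.1 x))
    ⟨φ0, h0, fun x hx => by
      obtain ⟨y, rfl⟩ := hI.ex0 x hx
      rw [h0e, hK.de]⟩ (by
    rintro n ⟨φ, hφ, hφd⟩
    obtain ⟨ψ, hψ, hψe⟩ := inj_extend (hK.inj (n + 1)) (d n) (hI.d_hom n) ((d' n).comp φ)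
      (hφ.comp' (hK.d_hom n)) hφd
    exact ⟨⟨ψ, hψ, fun x hx => by
      obtain ⟨y, rfl⟩ := hI.ex n x hx
      rw [hψe, LinearMap.comp_apply, hK.dd]⟩, hψe⟩)
  exact ⟨fun n => (f n).1, fun n => (f n).2.1, fun x => by simp only [hf0, h0e], hf⟩

lemma homotopy (hI : IsInjRes _ X I ε d) (hK : IsInjRes _ X K ε' d')
    (χ : ∀ n, (I n).M →ₗ[k] (K n).M) (hχ : ∀ n, IsHom k H (I n).ρ (K n).ρ (χ n))
    (h0 : ∀ x, χ 0 (ε x) = 0) (hc : ∀ n x, χ (n + 1) (d n x) = d' n (χ n x)) :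
    ∃ s : ∀ n, (I (n + 1)).M →ₗ[k] (K n).M, (∀ n, IsHom k H (I (n + 1)).ρ (K n).ρ (s n)) ∧
      (∀ x, χ 0 x = s 0 (d 0 x)) ∧
      ∀ n x, χ (n + 1) x = d' n (s n x) + s (n + 1) (d (n + 1) x) := by
  obtain ⟨s0, hs0, hs0e⟩ := inj_extend (hK.inj 0) (d 0) (hI.d_hom 0) (χ 0) (hχ 0) (fun x hx => by
    obtain ⟨y, rfl⟩ := hI.ex0 x hx
    exact h0 y)
  let T : ℕ → Type := fun n => {s : (I (n + 1)).M →ₗ[k] (K n).M //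
    IsHom k H (I (n + 1)).ρ (K n).ρ s ∧ ∀ x, χ (n + 1) (d n x) - d' n (s (d n x)) = 0}
  obtain ⟨f, hf0, hf⟩ := dep_rec (T := T)
    (fun n s t => ∀ x, t.1 (d (n + 1) x) = χ (n + 1) x - d' n (s.1 x))
    ⟨s0, hs0, fun x => by rw [hs0e, hc, sub_self]⟩ (by
    rintro n ⟨s, hs, hsd⟩
    have hh : IsHom k H (I (n + 1)).ρ (K (n + 1)).ρ (χ (n + 1) - (d' n).comp s) :=
      (homYD _ (I (n + 1)) (K (n + 1))).sub_mem (hχ (n + 1)) (hs.comp' (hK.d_hom n))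
    obtain ⟨t, ht, hte⟩ := inj_extend (hK.inj (n + 1)) (d (n + 1)) (hI.d_hom (n + 1))
      (χ (n + 1) - (d' n).comp s) hh (fun x hx => by
        obtain ⟨y, rfl⟩ := hI.ex n x hx
        exact hsd y)
    refine ⟨⟨t, ht, fun x => ?_⟩, hte⟩
    rw [hte, hc, LinearMap.sub_apply, LinearMap.comp_apply, map_sub, hK.dd, sub_zero, sub_self])
  refine ⟨fun n => (f n).1, fun n => (f n).2.1, fun x => ?_, fun n x => ?_⟩
  · simp only [hf0, hs0e]
  · simp only [hf]
    abel

end chain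

section lin
variable {V W : Type} [AddCommGroup V] [Module k V] [AddCommGroup W] [Module k W]

/-- The induced map on subquotients. -/
def subqMap (B Z : Submodule k V) (B' Z' : Submodule k W) (a : V →ₗ[k] W)
    (hB : ∀ x ∈ B, a x ∈ B') (hZ : ∀ x ∈ Z, a x ∈ Z') :
    ↥(Submodule.map B.mkQ Z) →ₗ[k] ↥(Submodule.map B'.mkQ Z') :=
  (Submodule.mapQ B B' a hB).restrict (by
    rintro _ ⟨z, hz, rfl⟩
    exact ⟨a z, hZ z hz, rfl⟩)

/-- Isomorphism of subquotients. -/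
def subqEquiv (B Z : Submodule k V) (B' Z' : Submodule k W) (a : V →ₗ[k] W) (b : W →ₗ[k] V)
    (hB : ∀ x ∈ B, a x ∈ B') (hZ : ∀ x ∈ Z, a x ∈ Z')
    (hB' : ∀ x ∈ B', b x ∈ B) (hZ' : ∀ x ∈ Z', b x ∈ Z)
    (hba : ∀ z ∈ Z, b (a z) - z ∈ B) (hab : ∀ z ∈ Z', a (b z) - z ∈ B') :
    ↥(Submodule.map B.mkQ Z) ≃ₗ[k] ↥(Submodule.map B'.mkQ Z') :=
  LinearEquiv.ofLinearMap (subqMap B Z B' Z' a hB hZ) (subqMap B' Z' B Z b hB' hZ')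
    (by
      apply LinearMap.ext
      rintro ⟨_, z, hz, rfl⟩
      apply Subtype.ext
      exact (Submodule.Quotient.eq B').2 (hab z hz))
    (by
      apply LinearMap.ext
      rintro ⟨_, z, hz, rfl⟩
      apply Subtype.ext
      exact (Submodule.Quotient.eq B).2 (hba z hz))
end lin

section coh
variable {X : YD k H} {I K : ℕ → YD k H} {ε : X.M →ₗ[k] (I 0).M} {ε' : X.M →ₗ[k] (K 0).M}
  {d : ∀ n, (I n).M →ₗ[k] (I (n + 1)).M} {d' : ∀ n, (K n).M →ₗ[k] (K (n + 1)).M}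

lemma chain_bd (A : YD k H) (hd) (hd')
    (φ : ∀ n, (I n).M →ₗ[k] (K n).M) (hφ : ∀ n, IsHom k H (I n).ρ (K n).ρ (φ n))
    (hc : ∀ n x, φ (n + 1) (d n x) = d' n (φ n x)) (i : ℕ) :
    ∀ x ∈ boundaries _ A I d hd i, postcompYD _ (φ i) (hφ i) x ∈ boundaries _ A K d' hd' i := by
  cases i with
  | zero =>
    intro x hx
    have hx : x = 0 := hx
    rw [hx, map_zero]
    exact Submodule.zero_mem _
  | succ i =>
    rintro _ ⟨x, rfl⟩
    refine ⟨postcompYD _ (φ i) (hφ i) x, ?_⟩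
    apply Subtype.ext
    apply LinearMap.ext
    intro a
    exact (hc i (x.1 a)).symm

lemma chain_cy (A : YD k H) (hd) (hd')
    (φ : ∀ n, (I n).M →ₗ[k] (K n).M) (hφ : ∀ n, IsHom k H (I n).ρ (K n).ρ (φ n))
    (hc : ∀ n x, φ (n + 1) (d n x) = d' n (φ n x)) (i : ℕ) :
    ∀ x ∈ LinearMap.ker (homCx _ A I d hd i),
      postcompYD _ (φ i) (hφ i) x ∈ LinearMap.ker (homCx _ A K d' hd' i) := by
  intro x hx
  rw [LinearMap.mem_ker] at hx ⊢
  apply Subtype.ext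
  apply LinearMap.ext
  intro a
  have h1 : d i (x.1 a) = 0 := congrArg (fun t => t.1 a) hx
  show d' i (φ i (x.1 a)) = 0
  rw [← hc, h1, map_zero]

lemma chain_htpy (hI : IsInjRes _ X I ε d) (A : YD k H) (hd)
    (χ : ∀ n, (I n).M →ₗ[k] (I n).M) (hχ : ∀ n, IsHom k H (I n).ρ (I n).ρ (χ n))
    (h0 : ∀ x, χ 0 (ε x) = ε x) (hc : ∀ n x, χ (n + 1) (d n x) = d n (χ n x)) (i : ℕ) :
    ∀ x ∈ LinearMap.ker (homCx _ A I d hd i),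
      postcompYD _ (χ i) (hχ i) x - x ∈ boundaries _ A I d hd i := by
  have hid : ∀ n, IsHom k H (I n).ρ (I n).ρ LinearMap.id := fun n =>
    ⟨fun _ _ => rfl, by rw [LinearMap.rTensor_id]; rfl⟩
  obtain ⟨s, hs, hs0, hs1⟩ := homotopy hI hI (fun n => χ n - LinearMap.id)
    (fun n => (homYD _ (I n) (I n)).sub_mem (hχ n) (hid n))
    (fun x => by simp [h0]) (fun n x => by simp [hc])
  intro x hx
  rw [LinearMap.mem_ker] at hx
  have h1 : ∀ a, d i (x.1 a) = 0 := fun a => congrArg (fun t => t.1 a) hx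
  cases i with
  | zero =>
    have : postcompYD _ (χ 0) (hχ 0) x - x = 0 := by
      apply Subtype.ext
      apply LinearMap.ext
      intro a
      have h2 := hs0 (x.1 a)
      rw [h1, map_zero] at h2
      exact h2
    rw [this]
    exact Submodule.zero_mem _
  | succ i =>
    refine ⟨postcompYD _ (s i) (hs i) x, ?_⟩
    apply Subtype.ext
    apply LinearMap.ext
    intro a
    have h2 := hs1 i (x.1 a)
    rw [h1, map_zero, add_zero] at h2
    exact h2.symm

lemma coh_iso (hI : IsInjRes _ X I ε d) (hK : IsInjRes _ X K ε' d') (A : YD k H) (hd) (hd')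
    (i : ℕ) : Nonempty (cohomology _ A I d hd i ≃ₗ[k] cohomology _ A K d' hd' i) := by
  obtain ⟨φ, hφ, hφ0, hφ1⟩ := chain_map hI hK
  obtain ⟨ψ, hψ, hψ0, hψ1⟩ := chain_map hK hI
  refine ⟨subqEquiv _ _ _ _ (postcompYD _ (φ i) (hφ i)) (postcompYD _ (ψ i) (hψ i))
    (chain_bd A hd hd' φ hφ hφ1 i) (chain_cy A hd hd' φ hφ hφ1 i)
    (chain_bd A hd' hd ψ hψ hψ1 i) (chain_cy A hd' hd ψ hψ hψ1 i) ?_ ?_⟩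
  · exact chain_htpy hI A hd (fun n => (ψ n).comp (φ n)) (fun n => (hφ n).comp' (hψ n))
      (fun x => by simp [hφ0, hψ0]) (fun n x => by simp [hφ1, hψ1]) i
  · exact chain_htpy hK A hd' (fun n => (φ n).comp (ψ n)) (fun n => (hψ n).comp' (hφ n))
      (fun x => by simp [hφ0, hψ0]) (fun n x => by simp [hφ1, hψ1]) i

lemma coh_adj (A N : YD k H) [Module.Finite H N.M] [Module.Projective H N.M]
    (J : ℕ → YD k H) (dJ : ∀ n, (J n).M →ₗ[k] (J (n + 1)).M)
    (hd : ∀ n, IsHom k H (J n).ρ (J (n + 1)).ρ (dJ n)) (i : ℕ) :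
    Nonempty (cohomology _ A (fun n => homR N (J n)) (fun n => Rmap N (dJ n) (hd n))
      (fun n => Rmap_isHom _ _) i ≃ₗ[k] cohomology _ (tens A N) J dJ hd i) := by
  have hF : ∀ n f, adjF A N (J (n + 1)) (homCx _ (tens A N) J dJ hd n f) =
      homCx _ A (fun n => homR N (J n)) (fun n => Rmap N (dJ n) (hd n))
        (fun n => Rmap_isHom _ _) n (adjF A N (J n) f) := fun n f => rfl
  have hG : ∀ n g, adjG A N (J (n + 1)) (homCx _ A (fun n => homR N (J n))
      (fun n => Rmap N (dJ n) (hd n)) (fun n => Rmap_isHom _ _) n g) =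
      homCx _ (tens A N) J dJ hd n (adjG A N (J n) g) := by
    intro n g
    conv_lhs => rw [← adjF_adjG g]
    rw [← hF, adjG_adjF]
  refine ⟨subqEquiv _ _ _ _ (adjG A N (J i)) (adjF A N (J i)) ?_ ?_ ?_ ?_ ?_ ?_⟩
  · cases i with
    | zero =>
      intro x hx
      have hx : x = 0 := hx
      rw [hx, map_zero]
      exact Submodule.zero_mem _
    | succ i =>
      rintro _ ⟨x, rfl⟩
      exact ⟨_, (hG i x).symm⟩
  · intro x hx
    rw [LinearMap.mem_ker] at hx ⊢
    rw [← hG, hx, map_zero]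
  · cases i with
    | zero =>
      intro x hx
      have hx : x = 0 := hx
      rw [hx, map_zero]
      exact Submodule.zero_mem _
    | succ i =>
      rintro _ ⟨x, rfl⟩
      exact ⟨_, (hF i x).symm⟩
  · intro x hx
    rw [LinearMap.mem_ker] at hx ⊢
    rw [← hF, hx, map_zero]
  · intro z _
    rw [adjF_adjG, sub_self]
    exact Submodule.zero_mem _
  · intro z _
    rw [adjG_adjF, sub_self]
    exact Submodule.zero_mem _

end coh

end Pf7


section Pf8
variable {k H : Type} [Field k] [CommRing H] [HopfAlgebra k H]

lemma final_aux (M N P : YD k H) [Module.Finite H N.M] [Module.Projective H N.M] (i : ℕ)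
    (I : ℕ → YD k H) (ε : (homR N P).M →ₗ[k] (I 0).M)
    (dI : ∀ n, (I n).M →ₗ[k] (I (n + 1)).M)
    (hI : IsInjRes _ (homR N P) I ε dI)
    (J : ℕ → YD k H) (ε' : P.M →ₗ[k] (J 0).M)
    (dJ : ∀ n, (J n).M →ₗ[k] (J (n + 1)).M)
    (hJ : IsInjRes _ P J ε' dJ) :
    Nonempty
      (cohomology _ M I dI hI.d_hom i ≃ₗ[k] cohomology _ (tens M N) J dJ hJ.d_hom i) := by
  have h1 := homR_injRes (N := N) hJ
  obtain ⟨e1⟩ := coh_iso hI h1 M hI.d_hom h1.d_hom i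
  obtain ⟨e2⟩ := coh_adj M N J dJ hJ.d_hom i
  exact ⟨LinearEquiv.trans e1 e2⟩

lemma rhoR_unique (N P : YD k H) [Module.Finite H N.M] [Module.Projective H N.M]
    (ρQ : (N.M →ₗ[H] P.M) →ₗ[k] (N.M →ₗ[H] P.M) ⊗[k] H)
    (hQchar : HomCoactChar _ N P ρQ) : ρQ = rhoR N P := by
  apply LinearMap.ext
  intro f
  apply E_inj'
  intro n
  rw [isRC_of_char N P ρQ hQchar, rhoR_rc]

lemma rhoT_unique (M N : YD k H)
    (ρT : (M.M ⊗[H] N.M) →ₗ[k] (M.M ⊗[H] N.M) ⊗[k] H)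
    (hTchar : TensorCoactChar _ M N ρT) : ρT = rhoT M N := by
  apply LinearMap.ext
  intro x
  exact TensorProduct.induction_on (motive := fun x => ρT x = rhoT M N x) x
    (by rw [map_zero, map_zero])
    (fun m n => by rw [isTC_of_char M N ρT hTchar, rhoT_tc])
    (fun u v hu hv => by rw [map_add, map_add, hu, hv])

end Pf8


/-- Proposition 2.2. Let `k` be a field, `H` a commutative Hopf
algebra over `k` with bijective antipode, and `M`, `N`, `P` Yetter-Drinfeld modules
with `N` finitely generated projective as a left `H`-module. Then for every `i ≥ 0`
there is a `k`-linear isomorphism `Ext^i(M, Hom_H(N, P)) ≅ Ext^i(M ⊗_H N, P)`,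
where `Ext^i` is the `i`-th right derived functor of `Hom_H^H(-, -)`, computed as
the `i`-th cohomology of the complex of `H`-linear `H`-colinear maps from the first
argument into an injective resolution of the second argument in the category of
Yetter-Drinfeld modules. -/
theorem ext_iso_homH_tensorH
    (k H : Type) [Field k] [CommRing H] [HopfAlgebra k H]
    (Sinv : H →ₗ[k] H)
    (hS1 : ∀ h : H, Sinv (HopfAlgebra.antipode (R := k) (A := H) h) = h)
    (hS2 : ∀ h : H, HopfAlgebra.antipode (R := k) (A := H) (Sinv h) = h)
    (M N P : YDCat k H Sinv)
    (hNfin : Module.Finite H N.M) (hNproj : Module.Projective H N.M)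
    -- the Yetter-Drinfeld module `Hom_H(N, P)`
    (ρQ : (N.M →ₗ[H] P.M) →ₗ[k] (N.M →ₗ[H] P.M) ⊗[k] H)
    (hQc : IsComod k H ρQ) (hQyd : IsYDCompat k H Sinv ρQ)
    (hQchar : HomCoactChar Sinv N P ρQ)
    -- the Yetter-Drinfeld module `M ⊗_H N`
    (ρT : (M.M ⊗[H] N.M) →ₗ[k] (M.M ⊗[H] N.M) ⊗[k] H)
    (hTc : IsComod k H ρT) (hTyd : IsYDCompat k H Sinv ρT)
    (hTchar : TensorCoactChar Sinv M N ρT)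
    (i : ℕ)
    -- an injective resolution of `Hom_H(N, P)`
    (I : ℕ → YDCat k H Sinv) (ε : (N.M →ₗ[H] P.M) →ₗ[k] (I 0).M)
    (dI : ∀ n, (I n).M →ₗ[k] (I (n + 1)).M)
    (hI : IsInjRes Sinv (YDCat.mk (M := N.M →ₗ[H] P.M) ρQ hQc hQyd) I ε dI)
    -- an injective resolution of `P`
    (J : ℕ → YDCat k H Sinv) (ε' : P.M →ₗ[k] (J 0).M)
    (dJ : ∀ n, (J n).M →ₗ[k] (J (n + 1)).M)
    (hJ : IsInjRes Sinv P J ε' dJ) :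
    Nonempty
      (cohomology Sinv M I dI hI.d_hom i ≃ₗ[k]
        cohomology Sinv (YDCat.mk (M := M.M ⊗[H] N.M) ρT hTc hTyd) J dJ hJ.d_hom i) := by
  obtain rfl := sinv_eq Sinv hS1
  obtain rfl := rhoR_unique N P ρQ hQchar
  obtain rfl := rhoT_unique M N ρT hTchar
  exact final_aux M N P i I ε dI hI J ε' dJ hJ
end YDPaper
end
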